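/- Fix integers d ≥ 2, D ≥ 2 and set α(d,D) := log( (d − 1/(dD²)) / ((1 + 1/D)(1 + 1/(dD))) ). There exist constants c₁, c₂ > 0 and N ∈ ℕ, all independent of n, H and A, such that for every n ≥ N, every Hermitian matrix H on (ℂ^d)^{⊗n} with non-degenerate spectrum and non-degenerate gaps, and every Hermitian observable A on (ℂ^d)^{⊗n} with operator norm ‖A‖ ≤ 1, the following holds: with probability at least 1 − e^{−c₂ α(d,D) n} over ψ drawn from μ_{d,n,D}, one has ψ ≠ 0 and the normalized vector ψ' := ψ/‖ψ‖ satisfies ΔA^∞_{ψ'} ≤ e^{−c₁ α(d,D) n}. -/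

import Mathlib

open MeasureTheory Matrix
open scoped ComplexConjugate

noncomputable section

instance matrixMeasurableSpace {m n : Type*} : MeasurableSpace (Matrix m n ℂ) :=
  MeasurableSpace.pi

/-- The site tensor `A^{(m)}_i = (⟨i| ⊗ 1_D) U (|0⟩ ⊗ 1_D)`. -/
def siteMat (d D : ℕ) [NeZero d] (U : Matrix.unitaryGroup (Fin d × Fin D) ℂ) (i : Fin d) :
    Matrix (Fin D) (Fin D) ℂ :=
  Matrix.of fun a b => (U : Matrix (Fin d × Fin D) (Fin d × Fin D) ℂ) (i, a) (0, b)

/-- The (unnormalized) matrix product state `ψ`, with periodic boundary conditions: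
`ψ(i₁,…,iₙ) = Tr[A^{(1)}_{i₁} ⋯ A^{(n)}_{iₙ}]`. -/
def mps (d D n : ℕ) [NeZero d] (U : Fin n → Matrix.unitaryGroup (Fin d × Fin D) ℂ) :
    (Fin n → Fin d) → ℂ :=
  fun idx => Matrix.trace (((List.finRange n).map fun m => siteMat d D (U m) (idx m)).prod)
/-- The random MPS as an element of the Euclidean (ℓ²) space `(ℂ^d)^{⊗n}`. -/
def mpsE (d D n : ℕ) [NeZero d] (U : Fin n → Matrix.unitaryGroup (Fin d × Fin D) ℂ) :
    EuclideanSpace ℂ (Fin n → Fin d) :=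
  (WithLp.equiv 2 ((Fin n → Fin d) → ℂ)).symm (mps d D n U)

/-- `α(d,D) = log((d − 1/(dD²)) / ((1 + 1/D)(1 + 1/(dD))))`. -/
def alphaDD (d D : ℕ) : ℝ :=
  Real.log (((d : ℝ) - 1 / ((d : ℝ) * (D : ℝ) ^ 2)) /
    ((1 + 1 / (D : ℝ)) * (1 + 1 / ((d : ℝ) * (D : ℝ)))))

/-- The Heisenberg-evolved expectation value `⟨ψ| e^{iHt} A e^{−iHt} |ψ⟩`. -/
def obsAt {ι : Type*} [Fintype ι] [DecidableEq ι] (H A : Matrix ι ι ℂ)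
    (ψ : EuclideanSpace ℂ ι) (t : ℝ) : ℂ :=
  inner ℂ ψ ((Matrix.toEuclideanCLM (𝕜 := ℂ)
    (NormedSpace.exp (((t : ℂ) * Complex.I) • H) * A *
      NormedSpace.exp ((-(t : ℂ) * Complex.I) • H))) ψ)

/-- The time average `(1/T) ∫₀^T f` converges to `L` as `T → ∞` (complex-valued). -/
def TimeAvgTendsto (f : ℝ → ℂ) (L : ℂ) : Prop :=
  Filter.Tendsto (fun T : ℝ => (T : ℂ)⁻¹ * ∫ t in Set.Ioc (0 : ℝ) T, f t)
    Filter.atTop (nhds L)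

/-- The time average `(1/T) ∫₀^T g` converges to `L` as `T → ∞` (real-valued). -/
def TimeAvgTendstoR (g : ℝ → ℝ) (L : ℝ) : Prop :=
  Filter.Tendsto (fun T : ℝ => T⁻¹ * ∫ t in Set.Ioc (0 : ℝ) T, g t)
    Filter.atTop (nhds L)

/-- Entries of the random projection `W W†`, with `W = U (|0⟩ ⊗ 1)`. -/
def prj {d D : ℕ} [NeZero d] (U : Matrix.unitaryGroup (Fin d × Fin D) ℂ)
    (p q : Fin d × Fin D) : ℂ :=
  ∑ b : Fin D, U.1 p (0, b) * conj (U.1 q (0, b))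

lemma measurable_uEntry {d D : ℕ} (p q : Fin d × Fin D) :
    Measurable (fun U : Matrix.unitaryGroup (Fin d × Fin D) ℂ => U.1 p q) := by
  have h1 : Measurable (fun U : Matrix.unitaryGroup (Fin d × Fin D) ℂ => U.1) :=
    measurable_subtype_coe
  have h2 : Measurable (fun M : Matrix (Fin d × Fin D) (Fin d × Fin D) ℂ => M p q) :=
    (measurable_pi_apply q).comp (measurable_pi_apply p)
  exact h2.comp h1

lemma measurable_prj {d D : ℕ} [NeZero d] (p q : Fin d × Fin D) :
    Measurable (fun U : Matrix.unitaryGroup (Fin d × Fin D) ℂ => prj U p q) := by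
  unfold prj
  refine Finset.measurable_sum _ fun b _ => ?_
  exact (measurable_uEntry _ _).mul (Complex.continuous_conj.measurable.comp (measurable_uEntry _ _))

lemma measurable_uMul {d D : ℕ} (V : Matrix.unitaryGroup (Fin d × Fin D) ℂ) :
    Measurable (fun U : Matrix.unitaryGroup (Fin d × Fin D) ℂ => V * U) := by
  refine Measurable.subtype_mk (measurable_pi_lambda _ fun p => measurable_pi_lambda _ fun q => ?_)
  simp only [Matrix.mul_apply]
  exact Finset.measurable_sum _ fun b _ => (measurable_uEntry _ _).const_mul _

lemma prj_mul {d D : ℕ} [NeZero d] (V U : Matrix.unitaryGroup (Fin d × Fin D) ℂ)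
    (p q : Fin d × Fin D) :
    prj (V * U) p q = ∑ p', ∑ q', V.1 p p' * conj (V.1 q q') * prj U p' q' := by
  unfold prj
  simp only [Matrix.UnitaryGroup.mul_val, Matrix.mul_apply, map_sum, map_mul, Finset.mul_sum]
  have h : ∀ b : Fin D, (∑ j, ∑ i, V.1 p i * U.1 i (0, b) * (conj (V.1 q j) * conj (U.1 j (0, b))))
      = ∑ i, ∑ j, V.1 p i * conj (V.1 q j) * (U.1 i (0, b) * conj (U.1 j (0, b))) := fun b => by
    rw [Finset.sum_comm]
    exact Finset.sum_congr rfl fun i _ => Finset.sum_congr rfl fun j _ => by ring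
  simp only [Finset.sum_mul, h]
  rw [Finset.sum_comm]
  exact Finset.sum_congr rfl fun i _ => Finset.sum_comm

lemma conj_prj {d D : ℕ} [NeZero d] (U : Matrix.unitaryGroup (Fin d × Fin D) ℂ)
    (p q : Fin d × Fin D) : conj (prj U p q) = prj U q p := by
  unfold prj
  simp only [map_sum, map_mul, Complex.conj_conj]
  exact Finset.sum_congr rfl fun b _ => mul_comm _ _

lemma u_orth {d D : ℕ} (U : Matrix.unitaryGroup (Fin d × Fin D) ℂ) (b c : Fin d × Fin D) :
    ∑ p, conj (U.1 p b) * U.1 p c = if b = c then 1 else 0 := by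
  have h : star U.1 * U.1 = 1 := (Matrix.mem_unitaryGroup_iff').1 U.2
  have := congrFun (congrFun h b) c
  simpa [Matrix.mul_apply, Matrix.star_apply, Matrix.one_apply] using this

lemma prj_trace {d D : ℕ} [NeZero d] (U : Matrix.unitaryGroup (Fin d × Fin D) ℂ) :
    ∑ p, prj U p p = D := by
  unfold prj
  rw [Finset.sum_comm]
  have : ∀ b : Fin D, ∑ p, U.1 p (0, b) * conj (U.1 p (0, b)) = 1 := fun b => by
    have := u_orth U (0, b) (0, b)
    simp only [if_true] at this
    rw [← this]
    exact Finset.sum_congr rfl fun p _ => mul_comm _ _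
  simp [this]

lemma prj_sq {d D : ℕ} [NeZero d] (U : Matrix.unitaryGroup (Fin d × Fin D) ℂ)
    (p q : Fin d × Fin D) : ∑ r, prj U p r * prj U r q = prj U p q := by
  unfold prj
  simp only [Finset.sum_mul_sum]
  rw [Finset.sum_comm]
  refine Finset.sum_congr rfl fun b _ => ?_
  rw [Finset.sum_comm]
  have : ∀ c : Fin D, ∑ r, U.1 p (0, b) * conj (U.1 r (0, b)) * (U.1 r (0, c) * conj (U.1 q (0, c)))
      = if b = c then U.1 p (0, b) * conj (U.1 q (0, c)) else 0 := fun c => by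
    have h := u_orth U (0, b) (0, c)
    have h2 : ∑ r, U.1 p (0, b) * conj (U.1 r (0, b)) * (U.1 r (0, c) * conj (U.1 q (0, c)))
      = (U.1 p (0, b) * conj (U.1 q (0, c))) * ∑ r, conj (U.1 r (0, b)) * U.1 r (0, c) := by
      rw [Finset.mul_sum]
      exact Finset.sum_congr rfl fun r _ => by ring
    rw [h2, h]
    simp
  simp [this]

lemma norm_prj_le {d D : ℕ} [NeZero d] (U : Matrix.unitaryGroup (Fin d × Fin D) ℂ)
    (p q : Fin d × Fin D) : ‖prj U p q‖ ≤ D := by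
  unfold prj
  refine (norm_sum_le _ _).trans ?_
  have : ∀ b : Fin D, ‖U.1 p (0, b) * conj (U.1 q (0, b))‖ ≤ 1 := fun b => by
    rw [norm_mul, RCLike.norm_conj]
    exact mul_le_one₀ (entry_norm_bound_of_unitary U.2 _ _) (norm_nonneg _)
      (entry_norm_bound_of_unitary U.2 _ _)
  refine (Finset.sum_le_sum fun b _ => this b).trans ?_
  simp

section onesite
variable {d D : ℕ} [NeZero d] (μ : Measure (Matrix.unitaryGroup (Fin d × Fin D) ℂ))

/-- Second moments of the random projection. -/
def mom (a b c e : Fin d × Fin D) : ℂ := ∫ U, prj U a b * prj U c e ∂μ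

lemma integrable_pp [IsProbabilityMeasure μ] (a b c e : Fin d × Fin D) :
    Integrable (fun U => prj U a b * prj U c e) μ := by
  refine Integrable.of_bound (C := (D : ℝ) * D)
    ((measurable_prj a b).mul (measurable_prj c e)).aestronglyMeasurable ?_
  refine Filter.Eventually.of_forall fun U => ?_
  rw [norm_mul]
  exact mul_le_mul (norm_prj_le _ _ _) (norm_prj_le _ _ _) (norm_nonneg _) (by positivity)

lemma mom_inv (hμ : ∀ V : Matrix.unitaryGroup (Fin d × Fin D) ℂ, μ.map (fun U => V * U) = μ)
    (V : Matrix.unitaryGroup (Fin d × Fin D) ℂ) (a b c e : Fin d × Fin D) :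
    mom μ a b c e = ∫ U, prj (V * U) a b * prj (V * U) c e ∂μ := by
  unfold mom
  conv_lhs => rw [← hμ V]
  rw [integral_map (measurable_uMul V).aemeasurable]
  exact ((measurable_prj a b).mul (measurable_prj c e)).aestronglyMeasurable

/-- diagonal unitary with phase `I` at `p` -/
def phaseU (p : Fin d × Fin D) : Matrix.unitaryGroup (Fin d × Fin D) ℂ :=
  ⟨Matrix.diagonal (fun q => if q = p then Complex.I else 1), by
    rw [Matrix.mem_unitaryGroup_iff]
    ext i j
    by_cases hij : i = j
    · subst hij
      by_cases h : i = p <;> simp [Matrix.star_eq_conjTranspose, Matrix.diagonal_conjTranspose, h]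
    · simp [Matrix.star_eq_conjTranspose, Matrix.diagonal_conjTranspose, hij]⟩

lemma prj_phase (p a b : Fin d × Fin D) (U : Matrix.unitaryGroup (Fin d × Fin D) ℂ) :
    prj (phaseU p * U) a b =
      (if a = p then Complex.I else 1) * conj (if b = p then Complex.I else 1) * prj U a b := by
  rw [prj_mul]
  simp [phaseU, Matrix.diagonal_apply, apply_ite conj, ite_mul, mul_ite]

lemma mom_phase (hμ : ∀ V : Matrix.unitaryGroup (Fin d × Fin D) ℂ, μ.map (fun U => V * U) = μ)
    (p a b c e : Fin d × Fin D) :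
    mom μ a b c e = ((if a = p then Complex.I else 1) * conj (if b = p then Complex.I else 1) *
      ((if c = p then Complex.I else 1) * conj (if e = p then Complex.I else 1))) *
      mom μ a b c e := by
  conv_lhs => rw [mom_inv μ hμ (phaseU p)]
  simp only [prj_phase]
  unfold mom
  rw [← integral_const_mul]
  congr 1
  ext U
  ring

lemma mom_zero (hμ : ∀ V : Matrix.unitaryGroup (Fin d × Fin D) ℂ, μ.map (fun U => V * U) = μ)
    (a b c e : Fin d × Fin D) (h1 : ¬ (a = b ∧ c = e)) (h2 : ¬ (a = e ∧ b = c)) :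
    mom μ a b c e = 0 := by
  have key : ∀ z w : ℂ, z = w * z → w ≠ 1 → z = 0 := fun z w h hw => by
    have : (w - 1) * z = 0 := by linear_combination -h
    rcases mul_eq_zero.1 this with h | h
    · exact absurd (sub_eq_zero.1 h) hw
    · exact h
  have hI : Complex.I ≠ 1 := fun h => by simpa using congrArg Complex.re h
  have hI2 : -Complex.I ≠ 1 := fun h => by simpa using congrArg Complex.re h
  have hI3 : (-1 : ℂ) ≠ 1 := by norm_num
  have ha := mom_phase μ hμ a a b c e
  have hc := mom_phase μ hμ c a b c e
  by_cases hab : a = b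
  · have hce : ¬ c = e := fun h => h1 ⟨hab, h⟩
    refine key _ _ hc ?_
    subst hab
    by_cases hac : a = c
    · subst hac
      simp [Ne.symm hce, hI]
    · simp [hac, Ne.symm hce, hI]
  · by_cases hae : a = e
    · have hbc : ¬ b = c := fun h => h2 ⟨hae, h⟩
      refine key _ _ hc ?_
      subst hae
      by_cases hac : a = c
      · subst hac
        simp [hbc, hI]
      · simp [hac, hbc, hI]
    · refine key _ _ ha ?_
      by_cases hca : c = a
      · simp [Ne.symm hab, Ne.symm hae, hca]; norm_num
      · simp [Ne.symm hab, Ne.symm hae, hca, hI]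
end onesite

section onesite2
variable {d D : ℕ} [NeZero d] (μ : Measure (Matrix.unitaryGroup (Fin d × Fin D) ℂ))

/-- permutation unitary -/
def permU (σ : Equiv.Perm (Fin d × Fin D)) : Matrix.unitaryGroup (Fin d × Fin D) ℂ :=
  ⟨Matrix.of fun p q => if σ p = q then 1 else 0, by
    rw [Matrix.mem_unitaryGroup_iff]
    ext i j
    simp [Matrix.mul_apply, Matrix.star_apply, Matrix.one_apply, apply_ite conj, eq_comm]⟩

lemma prj_perm (σ : Equiv.Perm (Fin d × Fin D)) (a b : Fin d × Fin D)
    (U : Matrix.unitaryGroup (Fin d × Fin D) ℂ) :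
    prj (permU σ * U) a b = prj U (σ a) (σ b) := by
  rw [prj_mul]
  simp [permU, apply_ite conj]

lemma mom_perm (hμ : ∀ V : Matrix.unitaryGroup (Fin d × Fin D) ℂ, μ.map (fun U => V * U) = μ)
    (σ : Equiv.Perm (Fin d × Fin D)) (a b c e : Fin d × Fin D) :
    mom μ a b c e = mom μ (σ a) (σ b) (σ c) (σ e) := by
  rw [mom_inv μ hμ (permU σ)]
  simp only [prj_perm]
  rfl

lemma exists_perm_pair {α : Type*} [DecidableEq α] {a b a' b' : α} (h : a ≠ b) (h' : a' ≠ b') :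
    ∃ σ : Equiv.Perm α, σ a = a' ∧ σ b = b' := by
  refine ⟨Equiv.swap (Equiv.swap a a' b) b' * Equiv.swap a a', ?_, ?_⟩
  · simp only [Equiv.Perm.mul_apply, Equiv.swap_apply_left]
    apply Equiv.swap_apply_of_ne_of_ne _ h'
    intro h2
    have : Equiv.swap a a' a = Equiv.swap a a' b := by simpa using h2
    exact h ((Equiv.swap a a').injective this)
  · simp

/-- the vector defining the reflection -/
def rvec (p q : Fin d × Fin D) : Fin d × Fin D → ℂ := Pi.single p 1 - (2 : ℂ) • Pi.single q 1

lemma rvec_dot {p q : Fin d × Fin D} (h : p ≠ q) : rvec p q ⬝ᵥ rvec p q = 5 := by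
  simp [rvec, h, h.symm]
  norm_num

lemma star_rvec (p q : Fin d × Fin D) : star (rvec p q) = rvec p q := by
  ext i
  have h2 : conj (2 : ℂ) = 2 := map_ofNat _ 2
  simp [rvec, Pi.single_apply, apply_ite conj, h2]

/-- reflection in the plane `p, q` -/
def reflU (p q : Fin d × Fin D) (h : p ≠ q) : Matrix.unitaryGroup (Fin d × Fin D) ℂ :=
  ⟨1 - (2 / 5 : ℂ) • Matrix.vecMulVec (rvec p q) (rvec p q), by
    rw [Matrix.mem_unitaryGroup_iff]
    have hs : star (1 - (2 / 5 : ℂ) • Matrix.vecMulVec (rvec p q) (rvec p q)) =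
        1 - (2 / 5 : ℂ) • Matrix.vecMulVec (rvec p q) (rvec p q) := by
      rw [star_sub, star_one, star_smul, Matrix.star_eq_conjTranspose,
        Matrix.conjTranspose_vecMulVec, star_rvec]
      simp
    have hh : Matrix.vecMulVec (rvec p q) (rvec p q) * Matrix.vecMulVec (rvec p q) (rvec p q)
        = (5 : ℂ) • Matrix.vecMulVec (rvec p q) (rvec p q) := by
      rw [Matrix.vecMulVec_mul_vecMulVec, rvec_dot h]
      ext i j
      simp [Matrix.vecMulVec_apply]
      try ring
    rw [hs, sub_mul, one_mul, mul_sub, mul_one, smul_mul_smul_comm, hh]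
    module⟩

lemma reflU_row {p q : Fin d × Fin D} (h : p ≠ q) (f : Fin d × Fin D → ℂ) :
    ∑ a, (reflU p q h).1 p a * f a = 3 / 5 * f p + 4 / 5 * f q := by
  simp [reflU, Matrix.vecMulVec_apply, rvec, Matrix.one_apply, sub_mul, h, mul_sub,
    Finset.sum_sub_distrib, Pi.single_apply]
  ring

lemma reflU_row_conj {p q : Fin d × Fin D} (h : p ≠ q) (f : Fin d × Fin D → ℂ) :
    ∑ a, conj ((reflU p q h).1 p a) * f a = 3 / 5 * f p + 4 / 5 * f q := by
  have := congrArg conj (reflU_row h (fun a => conj (f a)))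
  have h3 : conj (3 : ℂ) = 3 := map_ofNat _ 3
  have h4 : conj (4 : ℂ) = 4 := map_ofNat _ 4
  have h5 : conj (5 : ℂ) = 5 := map_ofNat _ 5
  simpa [h3, h4, h5] using this

lemma prj_refl {p q : Fin d × Fin D} (h : p ≠ q) (U : Matrix.unitaryGroup (Fin d × Fin D) ℂ) :
    prj (reflU p q h * U) p p = 9 / 25 * prj U p p + 12 / 25 * prj U p q + 12 / 25 * prj U q p
      + 16 / 25 * prj U q q := by
  rw [prj_mul]
  simp only [mul_assoc, ← Finset.mul_sum, reflU_row_conj h]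
  rw [reflU_row h]
  ring

lemma mom_refl [IsProbabilityMeasure μ]
    (hμ : ∀ V : Matrix.unitaryGroup (Fin d × Fin D) ℂ, μ.map (fun U => V * U) = μ)
    {p q : Fin d × Fin D} (h : p ≠ q) :
    mom μ p p p p = mom μ p p q q + mom μ p q q p := by
  have e := mom_inv μ hμ (reflU p q h) p p p p
  simp only [prj_refl h] at e
  have e2 : ∀ U : Matrix.unitaryGroup (Fin d × Fin D) ℂ,
      (9 / 25 * prj U p p + 12 / 25 * prj U p q + 12 / 25 * prj U q p
      + 16 / 25 * prj U q q) * (9 / 25 * prj U p p + 12 / 25 * prj U p q + 12 / 25 * prj U q p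
      + 16 / 25 * prj U q q) =
      81 / 625 * (prj U p p * prj U p p) + 256 / 625 * (prj U q q * prj U q q)
      + 288 / 625 * (prj U p p * prj U q q) + 288 / 625 * (prj U p q * prj U q p)
      + 144 / 625 * (prj U p q * prj U p q) + 144 / 625 * (prj U q p * prj U q p)
      + 216 / 625 * (prj U p p * prj U p q) + 216 / 625 * (prj U p p * prj U q p)
      + 384 / 625 * (prj U q q * prj U p q) + 384 / 625 * (prj U q q * prj U q p) := fun U => by
    ring
  simp only [e2] at e
  have I := fun (k : ℂ) (a b c e : Fin d × Fin D) => (integrable_pp μ a b c e).const_mul k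
  rw [integral_add (by fun_prop (disch := assumption)) (I _ _ _ _ _)] at e
  rw [integral_add (by fun_prop (disch := assumption)) (I _ _ _ _ _)] at e
  rw [integral_add (by fun_prop (disch := assumption)) (I _ _ _ _ _)] at e
  rw [integral_add (by fun_prop (disch := assumption)) (I _ _ _ _ _)] at e
  rw [integral_add (by fun_prop (disch := assumption)) (I _ _ _ _ _)] at e
  rw [integral_add (by fun_prop (disch := assumption)) (I _ _ _ _ _)] at e
  rw [integral_add (by fun_prop (disch := assumption)) (I _ _ _ _ _)] at e
  rw [integral_add (by fun_prop (disch := assumption)) (I _ _ _ _ _)] at e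
  rw [integral_add (I _ _ _ _ _) (I _ _ _ _ _)] at e
  simp only [integral_const_mul] at e
  change mom μ p p p p = 81 / 625 * mom μ p p p p + 256 / 625 * mom μ q q q q
      + 288 / 625 * mom μ p p q q + 288 / 625 * mom μ p q q p
      + 144 / 625 * mom μ p q p q + 144 / 625 * mom μ q p q p
      + 216 / 625 * mom μ p p p q + 216 / 625 * mom μ p p q p
      + 384 / 625 * mom μ q q p q + 384 / 625 * mom μ q q q p at e
  rw [mom_zero μ hμ p q p q (by simp [h]) (by simp [h]),
    mom_zero μ hμ q p q p (by simp [h.symm]) (by simp [h.symm]),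
    mom_zero μ hμ p p p q (by simp [h]) (by simp [h]),
    mom_zero μ hμ p p q p (by simp [h.symm]) (by simp [h]),
    mom_zero μ hμ q q p q (by simp [h]) (by simp [h.symm]),
    mom_zero μ hμ q q q p (by simp [h.symm]) (by simp [h.symm])] at e
  have e3 : mom μ q q q q = mom μ p p p p := by
    have := mom_perm μ hμ (Equiv.swap p q) p p p p
    simpa using this.symm
  rw [e3] at e
  linear_combination (625 / 288 : ℂ) * e
end onesite2

section onesite3
variable {d D : ℕ} [NeZero d] (μ : Measure (Matrix.unitaryGroup (Fin d × Fin D) ℂ))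

lemma mom_form [IsProbabilityMeasure μ] (hD : 2 ≤ D)
    (hμ : ∀ V : Matrix.unitaryGroup (Fin d × Fin D) ℂ, μ.map (fun U => V * U) = μ) :
    ∃ y z : ℝ, 0 ≤ z ∧ (y + z) * (d * (d * D + 1)) = D + 1 ∧
      ∀ a b c e : Fin d × Fin D, mom μ a b c e =
        (y : ℂ) * (if a = b ∧ c = e then 1 else 0) + (z : ℂ) * (if a = e ∧ b = c then 1 else 0) := by
  have hd0 : 0 < d := Nat.pos_of_ne_zero (NeZero.ne d)
  obtain ⟨a₀, b₀, hab⟩ : ∃ a₀ b₀ : Fin d × Fin D, a₀ ≠ b₀ :=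
    ⟨(0, ⟨0, by omega⟩), (0, ⟨1, by omega⟩), by simp⟩
  have hconj : ∀ a b c e, conj (mom μ a b c e) = mom μ b a e c := fun a b c e => by
    unfold mom
    rw [← integral_conj]
    simp only [map_mul, conj_prj]
  obtain ⟨y, hy⟩ : ∃ y : ℝ, mom μ a₀ a₀ b₀ b₀ = y :=
    ((Complex.conj_eq_iff_real).1 (hconj _ _ _ _))
  have hz1 : mom μ a₀ b₀ b₀ a₀ = ((∫ U, ‖prj U a₀ b₀‖ ^ 2 ∂μ : ℝ) : ℂ) := by
    unfold mom
    rw [← integral_complex_ofReal]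
    congr 1
    ext U
    rw [← conj_prj U a₀ b₀, Complex.mul_conj, Complex.normSq_eq_norm_sq]
  obtain ⟨z, hz, hz0⟩ : ∃ z : ℝ, mom μ a₀ b₀ b₀ a₀ = z ∧ 0 ≤ z :=
    ⟨_, hz1, integral_nonneg fun U => by positivity⟩
  have form : ∀ a b c e : Fin d × Fin D, mom μ a b c e =
        (y : ℂ) * (if a = b ∧ c = e then 1 else 0) + (z : ℂ) * (if a = e ∧ b = c then 1 else 0) := by
    have hY : ∀ a c, a ≠ c → mom μ a a c c = y := fun a c h => by
      obtain ⟨σ, h1, h2⟩ := exists_perm_pair hab h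
      rw [← hy, mom_perm μ hμ σ a₀ a₀ b₀ b₀, h1, h2]
    have hZ : ∀ a c, a ≠ c → mom μ a c c a = z := fun a c h => by
      obtain ⟨σ, h1, h2⟩ := exists_perm_pair hab h
      rw [← hz, mom_perm μ hμ σ a₀ b₀ b₀ a₀, h1, h2]
    intro a b c e
    by_cases h1 : a = b ∧ c = e
    · obtain ⟨rfl, rfl⟩ := h1
      by_cases hac : a = c
      · subst hac
        obtain ⟨q, hq⟩ : ∃ q, a ≠ q := by
          by_cases h : a = a₀
          · exact ⟨b₀, h ▸ hab⟩
          · exact ⟨a₀, h⟩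
        rw [mom_refl μ hμ hq, hY a q hq, hZ a q hq]
        simp
      · simp [hac, hY a c hac]
    · by_cases h2 : a = e ∧ b = c
      · obtain ⟨rfl, rfl⟩ := h2
        have hab' : a ≠ b := fun h => h1 ⟨h, h.symm⟩
        simp [hab', hZ a b hab']
      · rw [mom_zero μ hμ a b c e h1 h2]
        simp [h1, h2]
  refine ⟨y, z, hz0, ?_, form⟩
  have s1 : ∑ a : Fin d × Fin D, ∑ c : Fin d × Fin D, mom μ a a c c = (D : ℂ) * D := by
    unfold mom
    have : ∀ a : Fin d × Fin D, ∑ c, ∫ U, prj U a a * prj U c c ∂μ =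
        ∫ U, ∑ c, prj U a a * prj U c c ∂μ := fun a =>
      (integral_finsetSum _ fun c _ => integrable_pp μ a a c c).symm
    simp only [this]
    rw [← integral_finsetSum _ fun a _ => integrable_finsetSum _ fun c _ => integrable_pp μ a a c c]
    simp [← Finset.mul_sum, ← Finset.sum_mul, prj_trace]
  have s2 : ∑ a : Fin d × Fin D, ∑ c : Fin d × Fin D, mom μ a c c a = (D : ℂ) := by
    unfold mom
    have : ∀ a : Fin d × Fin D, ∑ c, ∫ U, prj U a c * prj U c a ∂μ =
        ∫ U, ∑ c, prj U a c * prj U c a ∂μ := fun a =>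
      (integral_finsetSum _ fun c _ => integrable_pp μ a c c a).symm
    simp only [this]
    rw [← integral_finsetSum _ fun a _ => integrable_finsetSum _ fun c _ => integrable_pp μ a c c a]
    simp [prj_sq, prj_trace]
  simp only [form] at s1 s2
  simp only [and_self, if_true, mul_one, Finset.sum_add_distrib, Finset.sum_const, Finset.card_univ,
    Fintype.card_prod, Fintype.card_fin, nsmul_eq_mul, mul_ite, mul_zero, Nat.cast_mul] at s1 s2
  have s1' : ((d : ℝ) * D) * (d * D * y) + d * D * z = D * D := by
    have : (((d : ℝ) * D) * (d * D * y) + d * D * z : ℂ) = D * D := by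
      rw [← s1]
      simp [Finset.sum_ite_eq]
    exact_mod_cast this
  have s2' : ((d : ℝ) * D) * y + (d * D) * (d * D * z) = D := by
    have : (((d : ℝ) * D) * y + (d * D) * (d * D * z) : ℂ) = D := by
      have hiff : ∀ x w : Fin d × Fin D, (x = w ∧ w = x) ↔ x = w :=
        fun x w => ⟨fun h => h.1, fun h => ⟨h, h.symm⟩⟩
      refine Eq.trans ?_ s2
      simp [hiff, Finset.sum_ite_eq]
    exact_mod_cast this
  have hD' : (D : ℝ) ≠ 0 := by positivity
  apply mul_left_cancel₀ hD'
  linear_combination s1' + s2'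
end onesite3

lemma sum_norm_sq_expand {X B : Type*} [Fintype X] [Fintype B] (Φ : X → ℂ) (G : X → B → ℂ) :
    ((∑ β, ‖∑ x, Φ x * G x β‖ ^ 2 : ℝ) : ℂ) =
      ∑ x, ∑ w, Φ x * conj (Φ w) * ∑ β, G x β * conj (G w β) := by
  push_cast
  have : ∀ β, ((‖∑ x, Φ x * G x β‖ : ℂ)) ^ 2 =
      ∑ x, ∑ w, Φ x * conj (Φ w) * (G x β * conj (G w β)) := fun β => by
    rw [← Complex.mul_conj', map_sum, Finset.sum_mul_sum]
    refine Finset.sum_congr rfl fun x _ => Finset.sum_congr rfl fun w _ => ?_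
    rw [map_mul]; ring
  simp only [this]
  rw [Finset.sum_comm]
  refine Finset.sum_congr rfl fun x _ => ?_
  rw [Finset.sum_comm]
  refine Finset.sum_congr rfl fun w _ => ?_
  rw [Finset.mul_sum]

section onesite4
variable {d D : ℕ} [NeZero d] (μ : Measure (Matrix.unitaryGroup (Fin d × Fin D) ℂ))

lemma lint_quad [IsProbabilityMeasure μ] {X B : Type*} [Fintype X] [Fintype B] (Φ : X → ℂ)
    (G : Matrix.unitaryGroup (Fin d × Fin D) ℂ → X → B → ℂ)
    (i1 i2 i3 i4 : X → X → Fin d × Fin D)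
    (hG : ∀ U x w, ∑ β, G U x β * conj (G U w β) =
      prj U (i1 x w) (i2 x w) * prj U (i3 x w) (i4 x w)) (C : ℝ)
    (hC : ∑ x, ∑ w, Φ x * conj (Φ w) * mom μ (i1 x w) (i2 x w) (i3 x w) (i4 x w) = C) :
    ∫⁻ U, ENNReal.ofReal (∑ β, ‖∑ x, Φ x * G U x β‖ ^ 2) ∂μ = ENNReal.ofReal C := by
  have e : ∀ U, ((∑ β, ‖∑ x, Φ x * G U x β‖ ^ 2 : ℝ) : ℂ) =
      ∑ x, ∑ w, Φ x * conj (Φ w) * (prj U (i1 x w) (i2 x w) * prj U (i3 x w) (i4 x w)) := fun U => by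
    rw [sum_norm_sq_expand]
    simp only [hG]
  have hi : Integrable (fun U => ((∑ β, ‖∑ x, Φ x * G U x β‖ ^ 2 : ℝ) : ℂ)) μ := by
    simp only [e]
    exact integrable_finsetSum _ fun x _ => integrable_finsetSum _ fun w _ =>
      (integrable_pp μ _ _ _ _).const_mul _
  have hi2 : Integrable (fun U => (∑ β, ‖∑ x, Φ x * G U x β‖ ^ 2 : ℝ)) μ := by
    have h := hi.re
    simp only [RCLike.re_eq_complex_re, Complex.ofReal_re] at h
    exact h
  rw [← ofReal_integral_eq_lintegral_ofReal hi2
    (Filter.Eventually.of_forall fun U => Finset.sum_nonneg fun β _ => by positivity)]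
  congr 1
  have : ((∫ U, (∑ β, ‖∑ x, Φ x * G U x β‖ ^ 2) ∂μ : ℝ) : ℂ) = (C : ℂ) := by
    rw [← integral_complex_ofReal]
    simp only [e]
    rw [integral_finsetSum _ fun x _ => integrable_finsetSum _ fun w _ =>
      (integrable_pp μ _ _ _ _).const_mul _, ← hC]
    refine Finset.sum_congr rfl fun x _ => ?_
    rw [integral_finsetSum _ fun w _ => (integrable_pp μ _ _ _ _).const_mul _]
    refine Finset.sum_congr rfl fun w _ => ?_
    rw [integral_const_mul]
    rfl
  exact_mod_cast this

/-- the per-site factor -/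
def lam (d D : ℕ) : ℝ := ((D : ℝ) + 1) / (d * (d * D + 1))

lemma oneA [IsProbabilityMeasure μ] (hD : 2 ≤ D)
    (hμ : ∀ V : Matrix.unitaryGroup (Fin d × Fin D) ℂ, μ.map (fun U => V * U) = μ)
    (Φ : (Fin d × Fin D) × (Fin d × Fin D) → ℂ) :
    ∫⁻ U, ENNReal.ofReal (∑ β : Fin D × Fin D,
        ‖∑ x, Φ x * (U.1 x.1 (0, β.1) * U.1 x.2 (0, β.2))‖ ^ 2) ∂μ
      ≤ ENNReal.ofReal (lam d D * ∑ x, ‖Φ x‖ ^ 2) := by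
  obtain ⟨y, z, hz, hyz, hm⟩ := mom_form μ hD hμ
  have hd0 : 0 < d := Nat.pos_of_ne_zero (NeZero.ne d)
  have hlam : lam d D = y + z := by
    unfold lam
    rw [div_eq_iff (by positivity), hyz]
  have hre : ∃ s : ℝ, ∑ x, Φ x * conj (Φ x.swap) = (s : ℂ) ∧ s ≤ ∑ x, ‖Φ x‖ ^ 2 := by
    have hc : conj (∑ x, Φ x * conj (Φ x.swap)) = ∑ x, Φ x * conj (Φ x.swap) := by
      rw [map_sum, ← (Equiv.prodComm (Fin d × Fin D) (Fin d × Fin D)).sum_comp]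
      refine Finset.sum_congr rfl fun x _ => ?_
      simp [mul_comm]
    obtain ⟨s, hs⟩ := Complex.conj_eq_iff_real.1 hc
    refine ⟨s, hs, ?_⟩
    have h1 : s ≤ ∑ x, ‖Φ x‖ * ‖Φ x.swap‖ := by
      calc s ≤ ‖(s : ℂ)‖ := by simpa using le_abs_self s
        _ = ‖∑ x, Φ x * conj (Φ x.swap)‖ := by rw [hs]
        _ ≤ ∑ x, ‖Φ x * conj (Φ x.swap)‖ := norm_sum_le _ _
        _ = _ := by simp
    have h2 : ∑ x : (Fin d × Fin D) × (Fin d × Fin D), ‖Φ x.swap‖ ^ 2 = ∑ x, ‖Φ x‖ ^ 2 :=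
      (Equiv.prodComm (Fin d × Fin D) (Fin d × Fin D)).sum_comp (fun x => ‖Φ x‖ ^ 2)
    have h3 : ∑ x, ‖Φ x‖ * ‖Φ x.swap‖ ≤ ∑ x : (Fin d × Fin D) × (Fin d × Fin D), (‖Φ x‖ ^ 2 + ‖Φ x.swap‖ ^ 2) / 2 :=
      Finset.sum_le_sum fun x _ => by nlinarith [sq_nonneg (‖Φ x‖ - ‖Φ x.swap‖)]
    rw [← Finset.sum_div, Finset.sum_add_distrib, h2] at h3
    linarith
  obtain ⟨s, hs, hsle⟩ := hre
  refine (lint_quad μ Φ (fun U x (β : Fin D × Fin D) => U.1 x.1 (0, β.1) * U.1 x.2 (0, β.2))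
    (fun x w => x.1) (fun x w => w.1) (fun x w => x.2) (fun x w => w.2) ?_
    (y * ∑ x, ‖Φ x‖ ^ 2 + z * s) ?_).trans_le ?_
  rotate_left 2
  · apply ENNReal.ofReal_le_ofReal
    rw [hlam, add_mul]
    gcongr
  · intro U x w
    unfold prj
    rw [Finset.sum_mul_sum, Fintype.sum_prod_type]
    refine Finset.sum_congr rfl fun b _ => Finset.sum_congr rfl fun c _ => ?_
    simp only [map_mul]
    ring
  · have hi1 : ∀ x w : (Fin d × Fin D) × (Fin d × Fin D), (x.1 = w.1 ∧ x.2 = w.2) ↔ x = w :=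
      fun x w => Prod.ext_iff.symm
    have hi2 : ∀ x w : (Fin d × Fin D) × (Fin d × Fin D), (x.1 = w.2 ∧ w.1 = x.2) ↔ x.swap = w :=
      fun x w => ⟨fun h => by ext1 <;> simp [h.1, h.2], fun h => by subst h; simp⟩
    simp only [hm, hi1, hi2, mul_add, Finset.sum_add_distrib]
    simp only [mul_ite, mul_one, mul_zero, Finset.sum_ite_eq, Finset.mem_univ, if_true,
      ← Finset.sum_mul, hs]
    push_cast
    simp only [Complex.mul_conj']
    ring

lemma oneB [IsProbabilityMeasure μ] (hD : 2 ≤ D)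
    (hμ : ∀ V : Matrix.unitaryGroup (Fin d × Fin D) ℂ, μ.map (fun U => V * U) = μ)
    (Y : (Fin d × Fin D) × (Fin d × Fin D) → ℂ) (hY : ∑ p, Y (p, p) = 0) :
    ∫⁻ U, ENNReal.ofReal (∑ β : Fin D × Fin D,
        ‖∑ x, Y x * (conj (U.1 x.1 (0, β.1)) * U.1 x.2 (0, β.2))‖ ^ 2) ∂μ
      ≤ ENNReal.ofReal (lam d D * ∑ x, ‖Y x‖ ^ 2) := by
  obtain ⟨y, z, hz, hyz, hm⟩ := mom_form μ hD hμ
  have hd0 : 0 < d := Nat.pos_of_ne_zero (NeZero.ne d)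
  have hlam : lam d D = y + z := by
    unfold lam
    rw [div_eq_iff (by positivity), hyz]
  refine (lint_quad μ Y (fun U x (β : Fin D × Fin D) => conj (U.1 x.1 (0, β.1)) * U.1 x.2 (0, β.2))
    (fun x w => w.1) (fun x w => x.1) (fun x w => x.2) (fun x w => w.2) ?_
    (y * ∑ x, ‖Y x‖ ^ 2) ?_).trans_le ?_
  rotate_left 2
  · apply ENNReal.ofReal_le_ofReal
    rw [hlam]
    gcongr
    linarith
  · intro U x w
    unfold prj
    rw [Finset.sum_mul_sum, Fintype.sum_prod_type]
    refine Finset.sum_congr rfl fun b _ => Finset.sum_congr rfl fun c _ => ?_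
    simp only [map_mul, Complex.conj_conj]
    ring
  · have hi1 : ∀ x w : (Fin d × Fin D) × (Fin d × Fin D), (w.1 = x.1 ∧ x.2 = w.2) ↔ x = w :=
      fun x w => ⟨fun h => by ext1 <;> simp [h.1, h.2], fun h => by subst h; simp⟩
    simp only [hm, hi1, mul_add, Finset.sum_add_distrib]
    have h0 : ∑ x : (Fin d × Fin D) × (Fin d × Fin D), ∑ w : (Fin d × Fin D) × (Fin d × Fin D),
        Y x * conj (Y w) * ((z : ℂ) * if w.1 = w.2 ∧ x.1 = x.2 then 1 else 0) = 0 := by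
      have : ∀ x w : (Fin d × Fin D) × (Fin d × Fin D),
          Y x * conj (Y w) * ((z : ℂ) * if w.1 = w.2 ∧ x.1 = x.2 then 1 else 0) =
          (if x.1 = x.2 then Y x else 0) * (z * if w.1 = w.2 then conj (Y w) else 0) := fun x w => by
        by_cases h1 : x.1 = x.2 <;> by_cases h2 : w.1 = w.2 <;> simp [h1, h2]
        ring
      simp only [this]
      rw [← Finset.sum_mul_sum]
      have : ∑ x : (Fin d × Fin D) × (Fin d × Fin D), (if x.1 = x.2 then Y x else 0) = 0 := by
        rw [Fintype.sum_prod_type]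
        simpa using hY
      rw [this, zero_mul]
    rw [h0, add_zero]
    simp only [mul_ite, mul_one, mul_zero, Finset.sum_ite_eq, Finset.mem_univ, if_true,
      ← Finset.sum_mul]
    push_cast
    simp only [Complex.mul_conj']
    ring
end onesite4

section chain
variable {d D : ℕ} [NeZero d]

/-- the matrix product `A_{i₁} ⋯ A_{iₙ}` -/
def mprod {n : ℕ} (U : Fin n → Matrix.unitaryGroup (Fin d × Fin D) ℂ) (idx : Fin n → Fin d) :
    Matrix (Fin D) (Fin D) ℂ :=
  ((List.finRange n).map fun m => siteMat d D (U m) (idx m)).prod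

lemma mprod_zero (U : Fin 0 → Matrix.unitaryGroup (Fin d × Fin D) ℂ) (idx : Fin 0 → Fin d) :
    mprod U idx = 1 := by
  simp [mprod]

lemma mprod_cons {n : ℕ} (U₀ : Matrix.unitaryGroup (Fin d × Fin D) ℂ)
    (U : Fin n → Matrix.unitaryGroup (Fin d × Fin D) ℂ) (i : Fin d) (idx : Fin n → Fin d) :
    mprod (Fin.cons U₀ U) (Fin.cons i idx) = siteMat d D U₀ i * mprod U idx := by
  simp [mprod, List.finRange_succ, List.map_map, Function.comp_def]

lemma measurable_mprod {n : ℕ} (idx : Fin n → Fin d) (b c : Fin D) :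
    Measurable (fun U : Fin n → Matrix.unitaryGroup (Fin d × Fin D) ℂ => mprod U idx b c) := by
  unfold mprod
  generalize List.finRange n = l
  induction l generalizing b c with
  | nil => simp
  | cons m l ih =>
    simp only [List.map_cons, List.prod_cons, Matrix.mul_apply]
    refine Finset.measurable_sum _ fun e _ => Measurable.mul ?_ (ih e c)
    exact (measurable_uEntry _ _).comp (measurable_pi_apply m)

lemma lintegral_cons {n : ℕ} (μ : Measure (Matrix.unitaryGroup (Fin d × Fin D) ℂ))
    [IsProbabilityMeasure μ]
    (f : (Fin (n + 1) → Matrix.unitaryGroup (Fin d × Fin D) ℂ) → ENNReal) (hf : Measurable f) :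
    ∫⁻ U, f U ∂(Measure.pi fun _ => μ) =
      ∫⁻ U₀, ∫⁻ U, f (Fin.cons U₀ U) ∂(Measure.pi fun _ => μ) ∂μ := by
  have h := (measurePreserving_piFinSuccAbove
    (fun _ : Fin (n + 1) => μ) 0).symm
  rw [← h.lintegral_comp hf]
  refine (lintegral_prod (μ := μ) (ν := Measure.pi fun _ : Fin n => μ) _
    (hf.comp h.measurable).aemeasurable).trans ?_
  refine lintegral_congr fun x => lintegral_congr fun y => ?_
  exact congrArg f (Fin.insertNth_zero' x y)

lemma sum_cons {n : ℕ} {β : Type*} [AddCommMonoid β] (f : (Fin (n + 1) → Fin d) → β) :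
    ∑ idx, f idx = ∑ i, ∑ idx : Fin n → Fin d, f (Fin.cons i idx) := by
  rw [← (Fin.consEquiv (fun _ : Fin (n + 1) => Fin d)).sum_comp, Fintype.sum_prod_type]
  rfl

lemma sum_site {n : ℕ} {β : Type*} [AddCommMonoid β] (f : (Fin (n + 1) → Fin d) × Fin D → β) :
    ∑ x, f x = ∑ idx : Fin n → Fin d, ∑ p : Fin d × Fin D, f (Fin.cons p.1 idx, p.2) := by
  rw [Fintype.sum_prod_type, sum_cons, Finset.sum_comm]
  refine Finset.sum_congr rfl fun idx _ => ?_
  rw [Fintype.sum_prod_type]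

lemma sum_site2 {n : ℕ} {β : Type*} [AddCommMonoid β]
    (f : ((Fin (n + 1) → Fin d) × Fin D) × ((Fin (n + 1) → Fin d) × Fin D) → β) :
    ∑ x, f x = ∑ η : (Fin n → Fin d) × (Fin n → Fin d),
      ∑ ξ : (Fin d × Fin D) × (Fin d × Fin D),
        f ((Fin.cons ξ.1.1 η.1, ξ.1.2), (Fin.cons ξ.2.1 η.2, ξ.2.2)) := by
  rw [Fintype.sum_prod_type, sum_site, Fintype.sum_prod_type]
  refine Finset.sum_congr rfl fun idx _ => ?_
  simp only [sum_site (n := n)]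
  rw [Finset.sum_comm]
  refine Finset.sum_congr rfl fun idx' _ => ?_
  exact (Fintype.sum_prod_type (fun ξ : (Fin d × Fin D) × (Fin d × Fin D) =>
    f ((Fin.cons ξ.1.1 idx, ξ.1.2), (Fin.cons ξ.2.1 idx', ξ.2.2)))).symm

lemma sum_split2 {n : ℕ} {β : Type*} [AddCommMonoid β]
    (f : ((Fin n → Fin d) × Fin D) × ((Fin n → Fin d) × Fin D) → β) :
    ∑ x, f x = ∑ η : (Fin n → Fin d) × (Fin n → Fin d), ∑ γ : Fin D × Fin D,
        f ((η.1, γ.1), (η.2, γ.2)) := by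
  simp only [Fintype.sum_prod_type]
  refine Finset.sum_congr rfl fun idx _ => ?_
  rw [Finset.sum_comm]

lemma chainA (μ : Measure (Matrix.unitaryGroup (Fin d × Fin D) ℂ)) [IsProbabilityMeasure μ]
    (hD : 2 ≤ D)
    (hμ : ∀ V : Matrix.unitaryGroup (Fin d × Fin D) ℂ, μ.map (fun U => V * U) = μ) (a : Fin D)
    (n : ℕ) (Φ : ((Fin n → Fin d) × Fin D) × ((Fin n → Fin d) × Fin D) → ℂ) :
    ∫⁻ U, ENNReal.ofReal (‖∑ x, Φ x * (mprod U x.1.1 x.1.2 a * mprod U x.2.1 x.2.2 a)‖ ^ 2)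
      ∂(Measure.pi fun _ : Fin n => μ) ≤ ENNReal.ofReal (lam d D ^ n * ∑ x, ‖Φ x‖ ^ 2) := by
  have hlam : 0 ≤ lam d D := by unfold lam; positivity
  induction n with
  | zero =>
    simp only [mprod_zero]
    rw [lintegral_const]
    simp only [measure_univ, mul_one, pow_zero, one_mul]
    apply ENNReal.ofReal_le_ofReal
    have h : ∑ x, Φ x * ((1 : Matrix (Fin D) (Fin D) ℂ) x.1.2 a *
        (1 : Matrix (Fin D) (Fin D) ℂ) x.2.2 a) = Φ ((default, a), (default, a)) := by
      rw [Finset.sum_eq_single ((default, a), (default, a))]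
      · simp
      · rintro ⟨⟨i, b⟩, ⟨j, c⟩⟩ _ hne
        by_cases hb : b = a
        · by_cases hc : c = a
          · exact absurd (by rw [hb, hc, Subsingleton.elim i default, Subsingleton.elim j default]) hne
          · simp [Matrix.one_apply, hc]
        · simp [Matrix.one_apply, hb]
      · simp
    rw [h]
    exact Finset.single_le_sum (f := fun x => ‖Φ x‖ ^ 2) (fun _ _ => by positivity)
      (Finset.mem_univ _)
  | succ n ih =>
    rw [lintegral_cons]
    swap
    · refine ENNReal.measurable_ofReal.comp (Measurable.pow_const (Measurable.norm ?_) 2)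
      exact Finset.measurable_sum _ fun x _ =>
        ((measurable_mprod _ _ _).mul (measurable_mprod _ _ _)).const_mul _
    have key : ∀ (U₀ : Matrix.unitaryGroup (Fin d × Fin D) ℂ)
        (U : Fin n → Matrix.unitaryGroup (Fin d × Fin D) ℂ),
        ∑ x, Φ x * (mprod (Fin.cons U₀ U : Fin (n + 1) → _) x.1.1 x.1.2 a *
          mprod (Fin.cons U₀ U : Fin (n + 1) → _) x.2.1 x.2.2 a) =
        ∑ w : ((Fin n → Fin d) × Fin D) × ((Fin n → Fin d) × Fin D),
          (∑ ξ : (Fin d × Fin D) × (Fin d × Fin D),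
            Φ ((Fin.cons ξ.1.1 w.1.1, ξ.1.2), (Fin.cons ξ.2.1 w.2.1, ξ.2.2)) *
              (U₀.1 ξ.1 (0, w.1.2) * U₀.1 ξ.2 (0, w.2.2))) *
          (mprod U w.1.1 w.1.2 a * mprod U w.2.1 w.2.2 a) := by
      intro U₀ U
      rw [sum_site2, sum_split2]
      refine Finset.sum_congr rfl fun η _ => ?_
      simp only [Finset.sum_mul]
      rw [Finset.sum_comm]
      refine Finset.sum_congr rfl fun ξ _ => ?_
      simp only [mprod_cons, Matrix.mul_apply]
      rw [Finset.sum_mul_sum, Fintype.sum_prod_type, Finset.mul_sum]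
      refine Finset.sum_congr rfl fun b _ => ?_
      rw [Finset.mul_sum]
      refine Finset.sum_congr rfl fun c _ => ?_
      simp only [siteMat, Matrix.of_apply]
      ring
    simp only [key]
    refine (lintegral_mono fun U₀ => ih _).trans ?_
    have e : ∀ U₀ : Matrix.unitaryGroup (Fin d × Fin D) ℂ,
      ENNReal.ofReal (lam d D ^ n * ∑ w : ((Fin n → Fin d) × Fin D) × ((Fin n → Fin d) × Fin D),
        ‖∑ ξ : (Fin d × Fin D) × (Fin d × Fin D),
            Φ ((Fin.cons ξ.1.1 w.1.1, ξ.1.2), (Fin.cons ξ.2.1 w.2.1, ξ.2.2)) *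
              (U₀.1 ξ.1 (0, w.1.2) * U₀.1 ξ.2 (0, w.2.2))‖ ^ 2) =
      ENNReal.ofReal (lam d D ^ n) * ∑ η : (Fin n → Fin d) × (Fin n → Fin d),
        ENNReal.ofReal (∑ γ : Fin D × Fin D, ‖∑ ξ : (Fin d × Fin D) × (Fin d × Fin D),
            Φ ((Fin.cons ξ.1.1 η.1, ξ.1.2), (Fin.cons ξ.2.1 η.2, ξ.2.2)) *
              (U₀.1 ξ.1 (0, γ.1) * U₀.1 ξ.2 (0, γ.2))‖ ^ 2) := by
      intro U₀
      rw [ENNReal.ofReal_mul (by positivity), sum_split2, ENNReal.ofReal_sum_of_nonneg]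
      intro η _
      positivity
    simp only [e]
    have hmeas : ∀ η : (Fin n → Fin d) × (Fin n → Fin d),
        Measurable (fun U₀ : Matrix.unitaryGroup (Fin d × Fin D) ℂ =>
        ENNReal.ofReal (∑ γ : Fin D × Fin D, ‖∑ ξ : (Fin d × Fin D) × (Fin d × Fin D),
            Φ ((Fin.cons ξ.1.1 η.1, ξ.1.2), (Fin.cons ξ.2.1 η.2, ξ.2.2)) *
              (U₀.1 ξ.1 (0, γ.1) * U₀.1 ξ.2 (0, γ.2))‖ ^ 2)) := fun η => by
      refine ENNReal.measurable_ofReal.comp (Finset.measurable_sum _ fun γ _ =>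
        Measurable.pow_const (Measurable.norm ?_) 2)
      exact Finset.measurable_sum _ fun x _ =>
        ((measurable_uEntry _ _).mul (measurable_uEntry _ _)).const_mul _
    rw [lintegral_const_mul _ (Finset.measurable_sum _ fun η _ => hmeas η),
      lintegral_finsetSum _ fun η _ => hmeas η]
    refine (mul_le_mul_right (Finset.sum_le_sum fun η _ => oneA μ hD hμ (fun ξ =>
      Φ ((Fin.cons ξ.1.1 η.1, ξ.1.2), (Fin.cons ξ.2.1 η.2, ξ.2.2)))) _).trans ?_
    rw [← ENNReal.ofReal_sum_of_nonneg (fun η _ => by positivity), ← ENNReal.ofReal_mul (by positivity),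
      ← Finset.mul_sum, sum_site2 (fun x => ‖Φ x‖ ^ 2), pow_succ, mul_assoc]
end chain

/-- traceless part -/
def tr0 {D : ℕ} (X : Matrix (Fin D) (Fin D) ℂ) : Matrix (Fin D) (Fin D) ℂ :=
  X - (X.trace / D) • 1

/-- squared Hilbert-Schmidt norm -/
def hsq {D : ℕ} (X : Matrix (Fin D) (Fin D) ℂ) : ℝ := ∑ γ : Fin D × Fin D, ‖X γ.1 γ.2‖ ^ 2

lemma hsq_nonneg {D : ℕ} (X : Matrix (Fin D) (Fin D) ℂ) : 0 ≤ hsq X :=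
  Finset.sum_nonneg fun _ _ => by positivity

lemma trace_tr0 {D : ℕ} (hD : 2 ≤ D) (X : Matrix (Fin D) (Fin D) ℂ) : (tr0 X).trace = 0 := by
  have : (D : ℂ) ≠ 0 := by
    have : D ≠ 0 := by omega
    exact_mod_cast this
  simp [tr0, Matrix.trace_sub, Matrix.trace_smul, this]

lemma tr0_sub_smul {D : ℕ} (hD : 2 ≤ D) (X : Matrix (Fin D) (Fin D) ℂ) (c : ℂ) :
    tr0 (X - c • 1) = tr0 X := by
  have : (D : ℂ) ≠ 0 := by
    have : D ≠ 0 := by omega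
    exact_mod_cast this
  unfold tr0
  have h : (X - c • (1 : Matrix (Fin D) (Fin D) ℂ)).trace / D = X.trace / D - c := by
    rw [Matrix.trace_sub, Matrix.trace_smul, Matrix.trace_one, Fintype.card_fin, smul_eq_mul]
    field_simp
  rw [h, sub_smul]
  abel

lemma hsq_tr0_le {D : ℕ} (hD : 2 ≤ D) (X : Matrix (Fin D) (Fin D) ℂ) : hsq (tr0 X) ≤ hsq X := by
  have hD0 : (D : ℂ) ≠ 0 := by
    have : D ≠ 0 := by omega
    exact_mod_cast this
  set t : ℂ := X.trace / D with ht
  have hsum : ∑ b, X b b = D * t := by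
    rw [ht]; field_simp; rfl
  have e : ((hsq (tr0 X) : ℝ) : ℂ) = ((hsq X - D * ‖t‖ ^ 2 : ℝ) : ℂ) := by
    unfold hsq tr0
    rw [← ht]
    push_cast
    simp only [← Complex.mul_conj']
    have h1 : ∀ γ : Fin D × Fin D, (X - t • (1 : Matrix (Fin D) (Fin D) ℂ)) γ.1 γ.2 *
        conj ((X - t • (1 : Matrix (Fin D) (Fin D) ℂ)) γ.1 γ.2) =
        X γ.1 γ.2 * conj (X γ.1 γ.2) + (if γ.1 = γ.2 then
          (t * conj t - t * conj (X γ.1 γ.2) - conj t * X γ.1 γ.2) else 0) := fun γ => by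
      by_cases h : γ.1 = γ.2 <;> simp [Matrix.one_apply, h]
      ring
    simp only [h1, Finset.sum_add_distrib]
    rw [sub_eq_add_neg]
    congr 1
    rw [Fintype.sum_prod_type]
    simp only [Finset.sum_ite_eq, Finset.mem_univ, if_true, Finset.sum_sub_distrib,
      ← Finset.mul_sum, ← map_sum, hsum]
    simp
    ring
  have e' : hsq (tr0 X) = hsq X - D * ‖t‖ ^ 2 := by exact_mod_cast e
  rw [e']
  have : 0 ≤ (D : ℝ) * ‖t‖ ^ 2 := by positivity
  linarith

section chainB
variable {d D : ℕ} [NeZero d]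

/-- one-site channel `X ↦ ∑ᵢ Aᵢ† X Aᵢ` -/
def chan (U : Matrix.unitaryGroup (Fin d × Fin D) ℂ) (X : Matrix (Fin D) (Fin D) ℂ) :
    Matrix (Fin D) (Fin D) ℂ := ∑ i, (siteMat d D U i)ᴴ * X * siteMat d D U i

/-- composed channel -/
def qch {n : ℕ} (U : Fin n → Matrix.unitaryGroup (Fin d × Fin D) ℂ)
    (X : Matrix (Fin D) (Fin D) ℂ) : Matrix (Fin D) (Fin D) ℂ :=
  ∑ idx, (mprod U idx)ᴴ * X * mprod U idx

lemma chan_one (U : Matrix.unitaryGroup (Fin d × Fin D) ℂ) : chan U 1 = 1 := by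
  ext b c
  have := u_orth U (0, b) (0, c)
  rw [Fintype.sum_prod_type] at this
  simp only [chan, mul_one, Matrix.sum_apply, Matrix.mul_apply, Matrix.conjTranspose_apply, siteMat,
    Matrix.of_apply, Matrix.one_apply]
  simpa using this

lemma qch_cons {n : ℕ} (U₀ : Matrix.unitaryGroup (Fin d × Fin D) ℂ)
    (U : Fin n → Matrix.unitaryGroup (Fin d × Fin D) ℂ) (X : Matrix (Fin D) (Fin D) ℂ) :
    qch (Fin.cons U₀ U : Fin (n + 1) → _) X = qch U (chan U₀ X) := by
  unfold qch chan
  rw [sum_cons, Finset.sum_comm]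
  refine Finset.sum_congr rfl fun idx _ => ?_
  rw [Finset.mul_sum, Finset.sum_mul]
  refine Finset.sum_congr rfl fun i _ => ?_
  rw [mprod_cons, Matrix.conjTranspose_mul]
  simp only [mul_assoc]

lemma qch_zero (U : Fin 0 → Matrix.unitaryGroup (Fin d × Fin D) ℂ)
    (X : Matrix (Fin D) (Fin D) ℂ) : qch U X = X := by
  unfold qch
  rw [Fintype.sum_unique]
  simp [mprod_zero]

lemma qch_one {n : ℕ} (U : Fin n → Matrix.unitaryGroup (Fin d × Fin D) ℂ) : qch U 1 = 1 := by
  induction n with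
  | zero => exact qch_zero U 1
  | succ n ih =>
    rw [← Fin.cons_self_tail U, qch_cons, chan_one, ih]

lemma qch_sub_smul {n : ℕ} (U : Fin n → Matrix.unitaryGroup (Fin d × Fin D) ℂ)
    (X Y : Matrix (Fin D) (Fin D) ℂ) (c : ℂ) : qch U (X - c • Y) = qch U X - c • qch U Y := by
  unfold qch
  simp only [mul_sub, sub_mul, Finset.sum_sub_distrib, Finset.smul_sum, Matrix.mul_smul,
    Matrix.smul_mul]

lemma qch_sum {n : ℕ} {ι : Type*} [Fintype ι] (U : Fin n → Matrix.unitaryGroup (Fin d × Fin D) ℂ)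
    (X : ι → Matrix (Fin D) (Fin D) ℂ) : qch U (∑ i, X i) = ∑ i, qch U (X i) := by
  unfold qch
  simp only [Finset.mul_sum, Finset.sum_mul]
  exact Finset.sum_comm

lemma tr0_qch_tr0 {n : ℕ} (hD : 2 ≤ D) (U : Fin n → Matrix.unitaryGroup (Fin d × Fin D) ℂ)
    (X : Matrix (Fin D) (Fin D) ℂ) : tr0 (qch U (tr0 X)) = tr0 (qch U X) := by
  conv_lhs => rw [tr0.eq_1 X, qch_sub_smul, qch_one, tr0_sub_smul hD]

lemma measurable_qch {n : ℕ} (X : Matrix (Fin D) (Fin D) ℂ) (b c : Fin D) :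
    Measurable (fun U : Fin n → Matrix.unitaryGroup (Fin d × Fin D) ℂ => qch U X b c) := by
  simp only [qch, Matrix.sum_apply, Matrix.mul_apply, Matrix.conjTranspose_apply]
  refine Finset.measurable_sum _ fun idx _ => Finset.measurable_sum _ fun e _ =>
    Measurable.mul (Finset.measurable_sum _ fun f _ => Measurable.mul_const ?_ _)
    (measurable_mprod _ _ _)
  exact Complex.continuous_conj.measurable.comp (measurable_mprod _ _ _)

lemma measurable_hsq_tr0_qch {n : ℕ} (X : Matrix (Fin D) (Fin D) ℂ) :
    Measurable (fun U : Fin n → Matrix.unitaryGroup (Fin d × Fin D) ℂ => hsq (tr0 (qch U X))) := by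
  unfold hsq tr0
  refine Finset.measurable_sum _ fun γ _ => Measurable.pow_const (Measurable.norm ?_) 2
  simp only [Matrix.sub_apply, Matrix.smul_apply, smul_eq_mul, Matrix.trace, Matrix.diag_apply]
  refine (measurable_qch _ _ _).sub (Measurable.mul_const (Measurable.div_const ?_ _) _)
  exact Finset.measurable_sum _ fun b _ => measurable_qch _ _ _

lemma oneB' (μ : Measure (Matrix.unitaryGroup (Fin d × Fin D) ℂ)) [IsProbabilityMeasure μ]
    (hD : 2 ≤ D)
    (hμ : ∀ V : Matrix.unitaryGroup (Fin d × Fin D) ℂ, μ.map (fun U => V * U) = μ)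
    (X : Matrix (Fin D) (Fin D) ℂ) (hX : X.trace = 0) :
    ∫⁻ U, ENNReal.ofReal (hsq (chan U X)) ∂μ ≤ ENNReal.ofReal ((d * lam d D) * hsq X) := by
  have h := oneB μ hD hμ (fun x => if x.1.1 = x.2.1 then X x.1.2 x.2.2 else 0) (by
    simp only [if_true]
    rw [Fintype.sum_prod_type]
    simp only [Matrix.trace, Matrix.diag_apply] at hX
    simp [hX])
  have hr : (d * lam d D) * hsq X = lam d D * ∑ x : (Fin d × Fin D) × (Fin d × Fin D),
      ‖if x.1.1 = x.2.1 then X x.1.2 x.2.2 else 0‖ ^ 2 := by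
    rw [mul_comm (d : ℝ), mul_assoc]
    congr 1
    unfold hsq
    simp only [Fintype.sum_prod_type]
    have : ∀ i : Fin d, ∑ b : Fin D, ∑ j : Fin d, ∑ c : Fin D,
        ‖if i = j then X b c else 0‖ ^ 2 = ∑ b, ∑ c, ‖X b c‖ ^ 2 := fun i => by
      refine Finset.sum_congr rfl fun b _ => ?_
      rw [Finset.sum_comm]
      refine Finset.sum_congr rfl fun c _ => ?_
      rw [Finset.sum_eq_single i] <;> simp +contextual [eq_comm]
    simp [this]
  rw [hr]
  convert h using 3 with U
  · congr 1
    unfold hsq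
    refine Finset.sum_congr rfl fun γ _ => ?_
    congr 2
    simp only [chan, Matrix.sum_apply, Matrix.mul_apply, Matrix.conjTranspose_apply, siteMat,
      Matrix.of_apply, Fintype.sum_prod_type, ite_mul, zero_mul, Finset.sum_mul]
    refine Finset.sum_congr rfl fun i _ => ?_
    rw [Finset.sum_comm]
    refine Finset.sum_congr rfl fun b _ => ?_
    rw [Finset.sum_comm]
    refine Finset.sum_congr rfl fun c _ => ?_
    simp only [Finset.sum_ite_eq, Finset.mem_univ, if_true, RCLike.star_def]
    ring

lemma chainB (μ : Measure (Matrix.unitaryGroup (Fin d × Fin D) ℂ)) [IsProbabilityMeasure μ]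
    (hD : 2 ≤ D)
    (hμ : ∀ V : Matrix.unitaryGroup (Fin d × Fin D) ℂ, μ.map (fun U => V * U) = μ)
    (n : ℕ) (X : Matrix (Fin D) (Fin D) ℂ) (hX : X.trace = 0) :
    ∫⁻ U, ENNReal.ofReal (hsq (tr0 (qch U X))) ∂(Measure.pi fun _ : Fin n => μ)
      ≤ ENNReal.ofReal ((d * lam d D) ^ n * hsq X) := by
  have hlam : 0 ≤ d * lam d D := by unfold lam; positivity
  induction n generalizing X with
  | zero =>
    simp only [qch_zero]
    rw [lintegral_const]
    simp only [measure_univ, mul_one, pow_zero, one_mul]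
    exact ENNReal.ofReal_le_ofReal (hsq_tr0_le hD X)
  | succ n ih =>
    rw [lintegral_cons μ (fun U => ENNReal.ofReal (hsq (tr0 (qch U X))))
      (ENNReal.measurable_ofReal.comp (measurable_hsq_tr0_qch X))]
    simp only [qch_cons]
    have h1 : ∀ U₀ : Matrix.unitaryGroup (Fin d × Fin D) ℂ,
        ∫⁻ U, ENNReal.ofReal (hsq (tr0 (qch U (chan U₀ X)))) ∂(Measure.pi fun _ : Fin n => μ) ≤
          ENNReal.ofReal ((d * lam d D) ^ n) * ENNReal.ofReal (hsq (chan U₀ X)) := fun U₀ => by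
      simp only [← tr0_qch_tr0 hD _ (chan U₀ X)]
      refine (ih _ (trace_tr0 hD _)).trans ?_
      rw [← ENNReal.ofReal_mul (by positivity)]
      apply ENNReal.ofReal_le_ofReal
      gcongr
      exact hsq_tr0_le hD _
    refine (lintegral_mono h1).trans ?_
    rw [lintegral_const_mul' _ _ ENNReal.ofReal_ne_top]
    refine (mul_le_mul_right (oneB' μ hD hμ X hX) _).trans ?_
    rw [← ENNReal.ofReal_mul (by positivity), pow_succ]
    exact le_of_eq (congrArg _ (by ring))
end chainB

section moments
variable {d D : ℕ} [NeZero d]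

lemma mps_eq {n : ℕ} (U : Fin n → Matrix.unitaryGroup (Fin d × Fin D) ℂ) (idx : Fin n → Fin d) :
    mps d D n U idx = ∑ a, mprod U idx a a := rfl

lemma measurable_mps {n : ℕ} (idx : Fin n → Fin d) :
    Measurable (fun U : Fin n → Matrix.unitaryGroup (Fin d × Fin D) ℂ => mps d D n U idx) := by
  simp only [mps_eq]
  exact Finset.measurable_sum _ fun a _ => measurable_mprod _ _ _

lemma fourth_a (μ : Measure (Matrix.unitaryGroup (Fin d × Fin D) ℂ)) [IsProbabilityMeasure μ]
    (hD : 2 ≤ D)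
    (hμ : ∀ V : Matrix.unitaryGroup (Fin d × Fin D) ℂ, μ.map (fun U => V * U) = μ)
    (n : ℕ) (a : Fin D) (u : (Fin n → Fin d) → ℂ) (hu : ∑ i, ‖u i‖ ^ 2 = 1) :
    ∫⁻ U, ENNReal.ofReal (‖∑ i, u i * mprod U i a a‖ ^ 4) ∂(Measure.pi fun _ : Fin n => μ)
      ≤ ENNReal.ofReal (lam d D ^ n) := by
  have h := chainA μ hD hμ a n (fun x => (u x.1.1 * if x.1.2 = a then 1 else 0) *
    (u x.2.1 * if x.2.2 = a then 1 else 0))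
  convert h using 3 with U
  · congr 1
    have e : ∀ z : ℂ, ‖z‖ ^ 4 = ‖z * z‖ ^ 2 := fun z => by rw [norm_mul]; ring
    rw [e]
    congr 2
    have e1 : ∑ i, u i * mprod U i a a = ∑ x : (Fin n → Fin d) × Fin D,
        (u x.1 * if x.2 = a then 1 else 0) * mprod U x.1 x.2 a := by
      rw [Fintype.sum_prod_type]
      simp
    rw [e1, Finset.sum_mul_sum]
    conv_rhs => rw [Fintype.sum_prod_type]
    refine Finset.sum_congr rfl fun x _ => Finset.sum_congr rfl fun y _ => ?_
    ring
  · have e1 : ∑ x : (Fin n → Fin d) × Fin D, ‖u x.1 * if x.2 = a then 1 else 0‖ ^ 2 = 1 := by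
      rw [Fintype.sum_prod_type, ← hu]
      refine Finset.sum_congr rfl fun x _ => ?_
      rw [Finset.sum_eq_single a] <;> simp +contextual
    have e2 := congrArg₂ (· * ·) e1 e1
    simp only [Finset.sum_mul_sum, mul_one] at e2
    conv_rhs => rw [Fintype.sum_prod_type]
    simp only [norm_mul, mul_pow] at e2 ⊢
    rw [e2, mul_one]

lemma fourth (μ : Measure (Matrix.unitaryGroup (Fin d × Fin D) ℂ)) [IsProbabilityMeasure μ]
    (hD : 2 ≤ D)
    (hμ : ∀ V : Matrix.unitaryGroup (Fin d × Fin D) ℂ, μ.map (fun U => V * U) = μ)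
    (n : ℕ) (u : (Fin n → Fin d) → ℂ) (hu : ∑ i, ‖u i‖ ^ 2 = 1) :
    ∫⁻ U, ENNReal.ofReal (‖∑ i, u i * mps d D n U i‖ ^ 4) ∂(Measure.pi fun _ : Fin n => μ)
      ≤ ENNReal.ofReal (D ^ 4 * lam d D ^ n) := by
  have hlam : 0 ≤ lam d D := by unfold lam; positivity
  have hD0 : (0 : ℝ) < D := by
    have : 0 < D := by omega
    exact_mod_cast this
  have h1 : ∀ U : Fin n → Matrix.unitaryGroup (Fin d × Fin D) ℂ,
      ENNReal.ofReal (‖∑ i, u i * mps d D n U i‖ ^ 4) ≤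
      ENNReal.ofReal (D ^ 3) * ∑ a, ENNReal.ofReal (‖∑ i, u i * mprod U i a a‖ ^ 4) := fun U => by
    rw [← ENNReal.ofReal_sum_of_nonneg (fun _ _ => by positivity),
      ← ENNReal.ofReal_mul (by positivity)]
    apply ENNReal.ofReal_le_ofReal
    have e1 : ∑ i, u i * mps d D n U i = ∑ a, ∑ i, u i * mprod U i a a := by
      rw [Finset.sum_comm]
      simp only [mps_eq, Finset.mul_sum]
    rw [e1]
    have h3 := pow_sum_div_card_le_sum_pow (s := (Finset.univ : Finset (Fin D)))
      (f := fun a => ‖∑ i, u i * mprod U i a a‖) (fun _ _ => norm_nonneg _) 3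
    rw [Finset.card_univ, Fintype.card_fin, div_le_iff₀ (by positivity), mul_comm] at h3
    refine le_trans ?_ h3
    gcongr
    exact norm_sum_le _ _
  refine (lintegral_mono h1).trans ?_
  rw [lintegral_const_mul' _ _ ENNReal.ofReal_ne_top, lintegral_finsetSum]
  swap
  · intro a _
    exact ENNReal.measurable_ofReal.comp (Measurable.pow_const (Measurable.norm
      (Finset.measurable_sum _ fun i _ => (measurable_mprod _ _ _).const_mul _)) 4)
  refine (mul_le_mul_right (Finset.sum_le_sum fun a _ => fourth_a μ hD hμ n a u hu) _).trans ?_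
  rw [Finset.sum_const, Finset.card_univ, Fintype.card_fin, nsmul_eq_mul,
    ← ENNReal.ofReal_natCast, ← ENNReal.ofReal_mul (by positivity),
    ← ENNReal.ofReal_mul (by positivity)]
  exact le_of_eq (congrArg _ (by ring))

lemma qch_single {n : ℕ} (U : Fin n → Matrix.unitaryGroup (Fin d × Fin D) ℂ) (a c : Fin D) :
    qch U (Matrix.single a c 1) a c = ∑ i, conj (mprod U i a a) * mprod U i c c := by
  unfold qch
  rw [Matrix.sum_apply]
  refine Finset.sum_congr rfl fun i _ => ?_
  rw [Matrix.mul_apply, Finset.sum_eq_single c]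
  · rw [Matrix.mul_apply, Finset.sum_eq_single a]
    · simp
    · intro b _ hb; simp [Matrix.single_apply, hb.symm]
    · simp
  · intro b _ hb
    rw [Matrix.mul_apply, Finset.sum_eq_zero, zero_mul]
    intro e _; simp [Matrix.single_apply, hb.symm]
  · simp

lemma normSq_mps {n : ℕ} (hD : 2 ≤ D) (U : Fin n → Matrix.unitaryGroup (Fin d × Fin D) ℂ) :
    ((∑ i, ‖mps d D n U i‖ ^ 2 - 1 : ℝ) : ℂ) =
      ∑ γ : Fin D × Fin D, tr0 (qch U (Matrix.single γ.1 γ.2 1)) γ.1 γ.2 := by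
  have hD0 : (D : ℂ) ≠ 0 := by
    have : D ≠ 0 := by omega
    exact_mod_cast this
  have h1 : ((∑ i, ‖mps d D n U i‖ ^ 2 : ℝ) : ℂ) =
      ∑ γ : Fin D × Fin D, qch U (Matrix.single γ.1 γ.2 1) γ.1 γ.2 := by
    simp only [qch_single]
    rw [Finset.sum_comm]
    push_cast
    refine Finset.sum_congr rfl fun i _ => ?_
    rw [← Complex.conj_mul', mps_eq, map_sum, Finset.sum_mul_sum, Fintype.sum_prod_type]
  have h2 : ∑ a : Fin D, (qch U (Matrix.single a a 1)).trace = D := by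
    rw [← Matrix.trace_sum, ← qch_sum]
    have : ∑ a : Fin D, Matrix.single a a (1 : ℂ) = 1 := by
      ext b c
      rw [Matrix.sum_apply]
      by_cases h : b = c
      · subst h; simp [Matrix.single_apply]
      · rw [Matrix.one_apply_ne h, Finset.sum_eq_zero]
        intro x _
        simp only [Matrix.single_apply]
        rw [if_neg]; rintro ⟨rfl, rfl⟩; exact h rfl
    rw [this, qch_one]
    simp
  rw [Complex.ofReal_sub, h1]
  simp only [tr0, Matrix.sub_apply, Finset.sum_sub_distrib]
  congr 1
  rw [Fintype.sum_prod_type]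
  simp only [Matrix.smul_apply, smul_eq_mul, Matrix.one_apply, mul_ite, mul_one, mul_zero,
    Finset.sum_ite_eq, Finset.mem_univ, if_true]
  rw [← Finset.sum_div, h2, div_self hD0]
  simp

lemma conc (μ : Measure (Matrix.unitaryGroup (Fin d × Fin D) ℂ)) [IsProbabilityMeasure μ]
    (hD : 2 ≤ D)
    (hμ : ∀ V : Matrix.unitaryGroup (Fin d × Fin D) ℂ, μ.map (fun U => V * U) = μ)
    (n : ℕ) :
    ∫⁻ U, ENNReal.ofReal ((∑ i, ‖mps d D n U i‖ ^ 2 - 1) ^ 2) ∂(Measure.pi fun _ : Fin n => μ)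
      ≤ ENNReal.ofReal (D ^ 4 * (d * lam d D) ^ n) := by
  have hlam : 0 ≤ d * lam d D := by unfold lam; positivity
  have h1 : ∀ U : Fin n → Matrix.unitaryGroup (Fin d × Fin D) ℂ,
      ENNReal.ofReal ((∑ i, ‖mps d D n U i‖ ^ 2 - 1) ^ 2) ≤
      ENNReal.ofReal (D ^ 2) * ∑ γ : Fin D × Fin D,
        ENNReal.ofReal (hsq (tr0 (qch U (tr0 (Matrix.single γ.1 γ.2 1))))) := fun U => by
    rw [← ENNReal.ofReal_sum_of_nonneg (fun _ _ => hsq_nonneg _),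
      ← ENNReal.ofReal_mul (by positivity)]
    apply ENNReal.ofReal_le_ofReal
    simp only [tr0_qch_tr0 hD]
    have e := congrArg norm (normSq_mps hD U)
    rw [Complex.norm_real, Real.norm_eq_abs] at e
    rw [← sq_abs, e]
    have h3 := sq_sum_le_card_mul_sum_sq (s := (Finset.univ : Finset (Fin D × Fin D)))
      (f := fun γ => ‖tr0 (qch U (Matrix.single γ.1 γ.2 1)) γ.1 γ.2‖)
    calc _ ≤ (∑ γ : Fin D × Fin D, ‖tr0 (qch U (Matrix.single γ.1 γ.2 1)) γ.1 γ.2‖) ^ 2 := by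
            gcongr; exact norm_sum_le _ _
      _ ≤ _ := h3
      _ ≤ _ := by
        rw [Finset.card_univ, Fintype.card_prod, Fintype.card_fin]
        push_cast
        rw [← sq]
        gcongr with γ
        exact Finset.single_le_sum
          (f := fun x => ‖tr0 (qch U (Matrix.single γ.1 γ.2 1)) x.1 x.2‖ ^ 2)
          (fun _ _ => by positivity) (Finset.mem_univ γ)
  refine (lintegral_mono h1).trans ?_
  rw [lintegral_const_mul' _ _ ENNReal.ofReal_ne_top, lintegral_finsetSum]
  swap
  · intro γ _
    exact ENNReal.measurable_ofReal.comp (measurable_hsq_tr0_qch _)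
  have h2 : ∀ γ : Fin D × Fin D, ∫⁻ U, ENNReal.ofReal (hsq (tr0 (qch U
      (tr0 (Matrix.single γ.1 γ.2 1))))) ∂(Measure.pi fun _ : Fin n => μ) ≤
        ENNReal.ofReal ((d * lam d D) ^ n) := fun γ => by
    refine (chainB μ hD hμ n _ (trace_tr0 hD _)).trans ?_
    apply ENNReal.ofReal_le_ofReal
    have h4 : hsq (Matrix.single γ.1 γ.2 (1 : ℂ)) = 1 := by
      unfold hsq
      rw [Finset.sum_eq_single γ]
      · simp
      · rintro x _ hx
        rw [Matrix.single_apply, if_neg]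
        · simp
        · rintro ⟨h, h'⟩; exact hx (Prod.ext h.symm h'.symm)
      · simp
    have h5 := (hsq_tr0_le hD (Matrix.single γ.1 γ.2 (1 : ℂ))).trans_eq h4
    have h6 : 0 ≤ (d * lam d D) ^ n := by positivity
    nlinarith
  refine (mul_le_mul_right (Finset.sum_le_sum fun γ _ => h2 γ) _).trans ?_
  rw [Finset.sum_const, Finset.card_univ, Fintype.card_prod, Fintype.card_fin, nsmul_eq_mul,
    ← ENNReal.ofReal_natCast, ← ENNReal.ofReal_mul (by positivity),
    ← ENNReal.ofReal_mul (by positivity)]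
  exact le_of_eq (congrArg _ (by push_cast; ring))
end moments

section equil

lemma timeavg_exp (ω : ℝ) (b : ℂ) :
    TimeAvgTendsto (fun t => b * Complex.exp ((ω * Complex.I) * t)) (if ω = 0 then b else 0) := by
  unfold TimeAvgTendsto
  split_ifs with h
  · refine tendsto_const_nhds.congr' ?_
    filter_upwards [Filter.eventually_gt_atTop (0 : ℝ)] with T hT
    have hT' : (T : ℂ) ≠ 0 := by exact_mod_cast hT.ne'
    rw [← intervalIntegral.integral_of_le hT.le]
    simp [h]
    field_simp
  · have hω : (ω : ℂ) * Complex.I ≠ 0 := by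
      simp [h]
    rw [tendsto_zero_iff_norm_tendsto_zero]
    have hlim : Filter.Tendsto (fun T : ℝ => T⁻¹ * (‖b‖ * (2 / ‖(ω : ℂ) * Complex.I‖)))
        Filter.atTop (nhds 0) := by
      have := (tendsto_inv_atTop_zero (𝕜 := ℝ)).mul_const (‖b‖ * (2 / ‖(ω : ℂ) * Complex.I‖))
      simpa using this
    refine tendsto_of_tendsto_of_tendsto_of_le_of_le' tendsto_const_nhds hlim ?_ ?_
    · exact Filter.Eventually.of_forall fun T => norm_nonneg _
    · filter_upwards [Filter.eventually_gt_atTop (0 : ℝ)] with T hT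
      rw [← intervalIntegral.integral_of_le hT.le, intervalIntegral.integral_const_mul,
        integral_exp_mul_complex hω, norm_mul, norm_mul, norm_div, norm_inv, Complex.norm_real,
        Real.norm_eq_abs, abs_of_pos hT]
      gcongr
      refine (norm_sub_le _ _).trans ?_
      have e : ∀ s : ℝ, ‖Complex.exp ((ω : ℂ) * Complex.I * s)‖ = 1 := fun s => by
        rw [show (ω : ℂ) * Complex.I * s = ((ω * s : ℝ) : ℂ) * Complex.I by push_cast; ring]
        exact Complex.norm_exp_ofReal_mul_I _
      rw [e, e]; norm_num

lemma timeavg_sum {σ : Type*} [Fintype σ] (ω : σ → ℝ) (b : σ → ℂ) :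
    TimeAvgTendsto (fun t => ∑ s, b s * Complex.exp ((ω s * Complex.I) * t))
      (∑ s, if ω s = 0 then b s else 0) := by
  have h := tendsto_finset_sum Finset.univ (fun s _ => timeavg_exp (ω s) (b s))
  unfold TimeAvgTendsto
  refine h.congr fun T => ?_
  rw [← Finset.mul_sum, integral_finset_sum]
  intro s _
  have hc : Continuous (fun t : ℝ => b s * Complex.exp ((ω s * Complex.I) * t)) := by fun_prop
  exact (hc.integrableOn_Icc (a := 0) (b := T)).mono_set Set.Ioc_subset_Icc_self

lemma timeavg_normSq {σ : Type*} [Fintype σ] (ω : σ → ℝ) (b : σ → ℂ)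
    (hω : ∀ p q, b p ≠ 0 → b q ≠ 0 → ω p = ω q → p = q) :
    TimeAvgTendstoR (fun t => ‖∑ s, b s * Complex.exp ((ω s * Complex.I) * t)‖ ^ 2)
      (∑ s, ‖b s‖ ^ 2) := by
  have h := timeavg_sum (fun p : σ × σ => ω p.1 - ω p.2) (fun p => b p.1 * conj (b p.2))
  have e1 : (∑ p : σ × σ, if ω p.1 - ω p.2 = 0 then b p.1 * conj (b p.2) else 0) =
      ((∑ s, ‖b s‖ ^ 2 : ℝ) : ℂ) := by
    rw [Fintype.sum_prod_type]
    push_cast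
    refine Finset.sum_congr rfl fun p _ => ?_
    rw [Finset.sum_eq_single p]
    · simp [Complex.mul_conj']
    · intro q _ hq
      split_ifs with h0
      · by_contra hne
        have hp : b p ≠ 0 := fun h => hne (by simp [h])
        have hq' : b q ≠ 0 := fun h => hne (by simp [h])
        exact hq (hω p q hp hq' (sub_eq_zero.mp h0)).symm
      · rfl
    · simp
  have e2 : ∀ t : ℝ, (∑ p : σ × σ, (b p.1 * conj (b p.2)) *
      Complex.exp (((ω p.1 - ω p.2 : ℝ) * Complex.I) * t)) =
      ((‖∑ s, b s * Complex.exp ((ω s * Complex.I) * t)‖ ^ 2 : ℝ) : ℂ) := fun t => by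
    push_cast
    rw [← Complex.mul_conj', map_sum, Finset.sum_mul_sum, Fintype.sum_prod_type]
    refine Finset.sum_congr rfl fun p _ => Finset.sum_congr rfl fun q _ => ?_
    rw [map_mul, ← Complex.exp_conj]
    simp only [map_mul, Complex.conj_ofReal, Complex.conj_I]
    rw [mul_mul_mul_comm, ← Complex.exp_add]
    congr 2
    ring
  unfold TimeAvgTendstoR
  unfold TimeAvgTendsto at h
  simp only [e1, e2, integral_complex_ofReal] at h
  have := (Complex.continuous_re.tendsto _).comp h
  refine (this.congr fun T => ?_)
  simp only [Function.comp]
  rw [← Complex.ofReal_inv, ← Complex.ofReal_mul, Complex.ofReal_re]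

variable {ι : Type*} [Fintype ι] [DecidableEq ι]

lemma exp_smul_herm (H : Matrix ι ι ℂ) (hH : H.IsHermitian) (z : ℂ) :
    NormedSpace.exp (z • H) = (hH.eigenvectorUnitary : Matrix ι ι ℂ) *
      Matrix.diagonal (fun j => Complex.exp (z * hH.eigenvalues j)) *
      (hH.eigenvectorUnitary : Matrix ι ι ℂ)ᴴ := by
  have h1 : z • H = (hH.eigenvectorUnitary : Matrix ι ι ℂ) *
      Matrix.diagonal (fun j => z * hH.eigenvalues j) *
      (hH.eigenvectorUnitary : Matrix ι ι ℂ)ᴴ := by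
    conv_lhs => rw [hH.spectral_theorem, Unitary.conjStarAlgAut_apply]
    rw [← Matrix.smul_mul, ← Matrix.mul_smul, ← Matrix.diagonal_smul]
    rfl
  have hU : (hH.eigenvectorUnitary : Matrix ι ι ℂ) * (hH.eigenvectorUnitary : Matrix ι ι ℂ)ᴴ = 1 :=
    Matrix.mem_unitaryGroup_iff.mp hH.eigenvectorUnitary.2
  have hinv : (hH.eigenvectorUnitary : Matrix ι ι ℂ)⁻¹ = (hH.eigenvectorUnitary : Matrix ι ι ℂ)ᴴ :=
    Matrix.inv_eq_right_inv hU
  rw [h1, ← hinv, Matrix.exp_conj _ _ (IsUnit.of_mul_eq_one _ hU), Matrix.exp_diagonal]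
  congr 3
  ext j
  rw [Pi.coe_exp, Complex.exp_eq_exp_ℂ]

lemma obsAt_eq (H : Matrix ι ι ℂ) (hH : H.IsHermitian) (A : Matrix ι ι ℂ)
    (φ : EuclideanSpace ℂ ι) (t : ℝ) :
    obsAt H A φ t = ∑ p : ι × ι,
      (conj (((hH.eigenvectorUnitary : Matrix ι ι ℂ)ᴴ *ᵥ φ.ofLp) p.1) *
        ((hH.eigenvectorUnitary : Matrix ι ι ℂ)ᴴ * A * (hH.eigenvectorUnitary : Matrix ι ι ℂ))
          p.1 p.2 * ((hH.eigenvectorUnitary : Matrix ι ι ℂ)ᴴ *ᵥ φ.ofLp) p.2) *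
      Complex.exp (((hH.eigenvalues p.1 - hH.eigenvalues p.2 : ℝ) * Complex.I) * t) := by
  unfold obsAt
  rw [EuclideanSpace.inner_eq_star_dotProduct, Matrix.ofLp_toEuclideanCLM,
    exp_smul_herm H hH, exp_smul_herm H hH]
  generalize (hH.eigenvectorUnitary : Matrix ι ι ℂ) = V
  set B := Vᴴ * A * V with hB
  set E1 := Matrix.diagonal (fun j => Complex.exp (t * Complex.I * hH.eigenvalues j)) with hE1
  set E2 := Matrix.diagonal (fun j => Complex.exp (-t * Complex.I * hH.eigenvalues j)) with hE2
  have h1 : V * E1 * Vᴴ * A * (V * E2 * Vᴴ) = V * (E1 * B * E2) * Vᴴ := by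
    rw [hB]; simp only [mul_assoc]
  rw [h1, dotProduct_comm, ← Matrix.mulVec_mulVec, ← Matrix.mulVec_mulVec,
    Matrix.dotProduct_mulVec]
  have h2 : star φ.ofLp ᵥ* V = star (Vᴴ *ᵥ φ.ofLp) := by
    rw [Matrix.star_mulVec, Matrix.conjTranspose_conjTranspose]
  rw [h2, Fintype.sum_prod_type]
  generalize Vᴴ *ᵥ φ.ofLp = c
  simp only [dotProduct, Matrix.mulVec, Finset.mul_sum]
  refine Finset.sum_congr rfl fun j _ => ?_
  refine Finset.sum_congr rfl fun k _ => ?_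
  rw [hE1, hE2, Matrix.mul_diagonal, Matrix.diagonal_mul]
  have h3 : Complex.exp (((hH.eigenvalues j - hH.eigenvalues k : ℝ) * Complex.I) * t) =
      Complex.exp (t * Complex.I * hH.eigenvalues j) *
      Complex.exp (-t * Complex.I * hH.eigenvalues k) := by
    rw [← Complex.exp_add]; congr 1; push_cast; ring
  rw [h3]
  simp only [Pi.star_apply, RCLike.star_def]
  ring

lemma col_le (B : Matrix ι ι ℂ) (hB : ‖Matrix.toEuclideanCLM (𝕜 := ℂ) B‖ ≤ 1) (k : ι) :
    ∑ j, ‖B j k‖ ^ 2 ≤ 1 := by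
  have h := (Matrix.toEuclideanCLM (𝕜 := ℂ) B).le_opNorm (EuclideanSpace.single k (1 : ℂ))
  have h1 : ‖Matrix.toEuclideanCLM (𝕜 := ℂ) B (EuclideanSpace.single k (1 : ℂ))‖ ≤ 1 := by
    refine h.trans ?_
    rw [PiLp.norm_single, norm_one, mul_one]
    exact hB
  have h2 := EuclideanSpace.norm_sq_eq (Matrix.toEuclideanCLM (𝕜 := ℂ) B
    (EuclideanSpace.single k (1 : ℂ)))
  have h3 : ∀ j, (Matrix.toEuclideanCLM (𝕜 := ℂ) B (EuclideanSpace.single k (1 : ℂ))) j = B j k :=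
    fun j => by
      rw [Matrix.ofLp_toEuclideanCLM]
      simp
  simp only [h3] at h2
  rw [← h2]
  exact pow_le_one₀ (norm_nonneg _) h1

lemma conj_opNorm_le (A : Matrix ι ι ℂ) (hA : ‖Matrix.toEuclideanCLM (𝕜 := ℂ) A‖ ≤ 1)
    (V : Matrix.unitaryGroup ι ℂ) :
    ‖Matrix.toEuclideanCLM (𝕜 := ℂ) ((V : Matrix ι ι ℂ)ᴴ * A * (V : Matrix ι ι ℂ))‖ ≤ 1 := by
  have hm : ∀ W : Matrix ι ι ℂ, W ∈ Matrix.unitaryGroup ι ℂ →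
      Matrix.toEuclideanCLM (𝕜 := ℂ) W ∈ unitary _ := fun W hW => by
    rw [Unitary.mem_iff]
    rw [← map_star, ← map_mul, ← map_mul, Matrix.mem_unitaryGroup_iff.mp hW,
      Matrix.mem_unitaryGroup_iff'.mp hW, map_one]
    exact ⟨rfl, rfl⟩
  rw [map_mul, map_mul, CStarRing.norm_mul_mem_unitary _ (hm _ V.2),
    CStarRing.norm_mem_unitary_mul _ (hm _ ?_)]
  · exact hA
  · exact Unitary.star_mem V.2

lemma equilib (H : Matrix ι ι ℂ) (hH : H.IsHermitian)
    (hinj : Function.Injective hH.eigenvalues)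
    (hgap : ∀ j k l m : ι, j ≠ k → l ≠ m →
          hH.eigenvalues j - hH.eigenvalues k = hH.eigenvalues l - hH.eigenvalues m →
          j = l ∧ k = m)
    (A : Matrix ι ι ℂ) (hA : A.IsHermitian) (hA1 : ‖Matrix.toEuclideanCLM (𝕜 := ℂ) A‖ ≤ 1)
    (φ : EuclideanSpace ℂ ι) :
    ∃ (Ainf : ℂ) (Δ : ℝ), TimeAvgTendsto (obsAt H A φ) Ainf ∧
      TimeAvgTendstoR (fun t => ‖obsAt H A φ t - Ainf‖ ^ 2) Δ ∧
      Δ ≤ ∑ j, ‖((hH.eigenvectorUnitary : Matrix ι ι ℂ)ᴴ *ᵥ φ.ofLp) j‖ ^ 4 := by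
  set V := (hH.eigenvectorUnitary : Matrix ι ι ℂ) with hV
  set c := Vᴴ *ᵥ φ.ofLp with hc
  set B := Vᴴ * A * V with hB
  set E := hH.eigenvalues
  have hobs : obsAt H A φ = fun t : ℝ => ∑ p : ι × ι, (conj (c p.1) * B p.1 p.2 * c p.2) *
      Complex.exp (((E p.1 - E p.2 : ℝ) * Complex.I) * t) := funext fun t => obsAt_eq H hH A φ t
  have hcol : ∀ k, ∑ j, ‖B j k‖ ^ 2 ≤ 1 := col_le B (conj_opNorm_le A hA1 hH.eigenvectorUnitary)
  have hherm : B.IsHermitian := by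
    rw [hB]; exact Matrix.isHermitian_conjTranspose_mul_mul V hA
  have hrow : ∀ j, ∑ k, ‖B j k‖ ^ 2 ≤ 1 := fun j => by
    refine le_trans (le_of_eq ?_) (hcol j)
    refine Finset.sum_congr rfl fun k _ => ?_
    rw [← hherm.apply j k, norm_star]
  let β : ι × ι → ℂ := fun p => if p.1 = p.2 then 0 else conj (c p.1) * B p.1 p.2 * c p.2
  refine ⟨∑ p : ι × ι, if E p.1 - E p.2 = 0 then conj (c p.1) * B p.1 p.2 * c p.2 else 0,
    ∑ p, ‖β p‖ ^ 2, ?_, ?_, ?_⟩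
  · rw [hobs]
    exact timeavg_sum (fun p : ι × ι => E p.1 - E p.2) _
  · have h := timeavg_normSq (fun p : ι × ι => E p.1 - E p.2) β (by
      rintro ⟨j, k⟩ ⟨l, m⟩ h1 h2 h3
      have hjk : j ≠ k := fun h => h1 (if_pos h)
      have hlm : l ≠ m := fun h => h2 (if_pos h)
      obtain ⟨rfl, rfl⟩ := hgap j k l m hjk hlm h3
      rfl)
    convert h using 4 with t
    rw [hobs]
    simp only
    rw [← Finset.sum_sub_distrib]
    refine Finset.sum_congr rfl fun p _ => ?_
    by_cases hp : p.1 = p.2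
    · simp [β, hp]
    · have : E p.1 - E p.2 ≠ 0 := fun h => hp (hinj (sub_eq_zero.mp h))
      simp [β, hp, this]
  · have h1 : ∀ p : ι × ι, ‖β p‖ ^ 2 ≤
        ‖c p.1‖ ^ 4 / 2 * ‖B p.1 p.2‖ ^ 2 + ‖c p.2‖ ^ 4 / 2 * ‖B p.1 p.2‖ ^ 2 := fun p => by
      by_cases hp : p.1 = p.2
      · have h0 : β p = 0 := if_pos hp
        rw [h0, norm_zero]
        have : 0 ≤ ‖c p.1‖ ^ 4 / 2 * ‖B p.1 p.2‖ ^ 2 + ‖c p.2‖ ^ 4 / 2 * ‖B p.1 p.2‖ ^ 2 := by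
          positivity
        simpa using this
      · simp only [β, hp, if_false]
        rw [norm_mul, norm_mul, RCLike.norm_conj, mul_pow, mul_pow]
        have : 0 ≤ ‖B p.1 p.2‖ ^ 2 * (‖c p.1‖ ^ 2 - ‖c p.2‖ ^ 2) ^ 2 := by positivity
        nlinarith
    refine (Finset.sum_le_sum fun p _ => h1 p).trans ?_
    rw [Finset.sum_add_distrib]
    have h2 : ∑ p : ι × ι, ‖c p.1‖ ^ 4 / 2 * ‖B p.1 p.2‖ ^ 2 ≤ ∑ j, ‖c j‖ ^ 4 / 2 := by
      rw [Fintype.sum_prod_type]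
      refine Finset.sum_le_sum fun j _ => ?_
      simp only [← Finset.mul_sum]
      exact mul_le_of_le_one_right (by positivity) (hrow j)
    have h3 : ∑ p : ι × ι, ‖c p.2‖ ^ 4 / 2 * ‖B p.1 p.2‖ ^ 2 ≤ ∑ j, ‖c j‖ ^ 4 / 2 := by
      rw [Fintype.sum_prod_type_right]
      refine Finset.sum_le_sum fun j _ => ?_
      simp only [← Finset.mul_sum]
      exact mul_le_of_le_one_right (by positivity) (hcol j)
    rw [← Finset.sum_div] at h2 h3
    linarith
end equil

section final
variable {d D : ℕ} [NeZero d]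

lemma markov_real {Ω : Type*} [MeasurableSpace Ω] (ν : Measure Ω) (f : Ω → ℝ) (hf : Measurable f)
    (C ε : ℝ) (hε : 0 < ε) (h : ∫⁻ x, ENNReal.ofReal (f x) ∂ν ≤ ENNReal.ofReal C) :
    ν {x | ε ≤ f x} ≤ ENNReal.ofReal (C / ε) := by
  have h1 := meas_ge_le_lintegral_div (μ := ν) (f := fun x => ENNReal.ofReal (f x))
    (ENNReal.measurable_ofReal.comp hf).aemeasurable (ε := ENNReal.ofReal ε)
    (by simpa using hε) ENNReal.ofReal_ne_top
  rw [ENNReal.ofReal_div_of_pos hε]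
  refine (measure_mono ?_).trans (h1.trans (ENNReal.div_le_div_right h _))
  intro x hx
  exact ENNReal.ofReal_le_ofReal hx

lemma fourth_sum (μ : Measure (Matrix.unitaryGroup (Fin d × Fin D) ℂ)) [IsProbabilityMeasure μ]
    (hD : 2 ≤ D)
    (hμ : ∀ V : Matrix.unitaryGroup (Fin d × Fin D) ℂ, μ.map (fun U => V * U) = μ)
    (n : ℕ) (V : Matrix.unitaryGroup (Fin n → Fin d) ℂ) :
    ∫⁻ U, ENNReal.ofReal (∑ j, ‖((V : Matrix (Fin n → Fin d) (Fin n → Fin d) ℂ)ᴴ *ᵥ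
        mps d D n U) j‖ ^ 4) ∂(Measure.pi fun _ : Fin n => μ)
      ≤ ENNReal.ofReal (D ^ 4 * (d * lam d D) ^ n) := by
  have hlam : 0 ≤ lam d D := by unfold lam; positivity
  simp only [ENNReal.ofReal_sum_of_nonneg
    (fun (_ : Fin n → Fin d) (_ : _ ∈ Finset.univ) => pow_nonneg (norm_nonneg _) 4)]
  rw [lintegral_finsetSum]
  swap
  · intro j _
    refine ENNReal.measurable_ofReal.comp (Measurable.pow_const (Measurable.norm ?_) 4)
    exact Finset.measurable_sum _ fun i _ => (measurable_mps i).const_mul _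
  have h1 : ∀ j, ∫⁻ U, ENNReal.ofReal (‖((V : Matrix (Fin n → Fin d) (Fin n → Fin d) ℂ)ᴴ *ᵥ
        mps d D n U) j‖ ^ 4) ∂(Measure.pi fun _ : Fin n => μ)
      ≤ ENNReal.ofReal (D ^ 4 * lam d D ^ n) := fun j => by
    refine fourth μ hD hμ n
      (fun i => (V : Matrix (Fin n → Fin d) (Fin n → Fin d) ℂ)ᴴ j i) ?_
    have hV := congrFun (congrFun (Matrix.mem_unitaryGroup_iff'.mp V.2) j) j
    rw [Matrix.star_eq_conjTranspose, Matrix.mul_apply, Matrix.one_apply_eq] at hV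
    have : ((∑ i, ‖(V : Matrix (Fin n → Fin d) (Fin n → Fin d) ℂ)ᴴ j i‖ ^ 2 : ℝ) : ℂ) = 1 := by
      rw [← hV]
      push_cast
      refine Finset.sum_congr rfl fun i _ => ?_
      rw [← Complex.mul_conj']
      simp
    exact_mod_cast this
  refine (Finset.sum_le_sum fun j _ => h1 j).trans ?_
  rw [Finset.sum_const, Finset.card_univ, Fintype.card_fun, Fintype.card_fin, Fintype.card_fin,
    nsmul_eq_mul, ← ENNReal.ofReal_natCast, ← ENNReal.ofReal_mul (by positivity)]
  exact le_of_eq (congrArg _ (by push_cast; ring))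

lemma good_of (n : ℕ) (U : Fin n → Matrix.unitaryGroup (Fin d × Fin D) ℂ)
    (H : Matrix (Fin n → Fin d) (Fin n → Fin d) ℂ) (hH : H.IsHermitian)
    (hinj : Function.Injective hH.eigenvalues)
    (hgap : ∀ j k l m : Fin n → Fin d, j ≠ k → l ≠ m →
          hH.eigenvalues j - hH.eigenvalues k = hH.eigenvalues l - hH.eigenvalues m →
          j = l ∧ k = m)
    (A : Matrix (Fin n → Fin d) (Fin n → Fin d) ℂ) (hA : A.IsHermitian)
    (hA1 : ‖Matrix.toEuclideanCLM (𝕜 := ℂ) A‖ ≤ 1) (x : ℝ)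
    (h1 : (∑ i, ‖mps d D n U i‖ ^ 2 - 1) ^ 2 < 1 / 4)
    (h2 : ∑ j, ‖((hH.eigenvectorUnitary : Matrix (Fin n → Fin d) (Fin n → Fin d) ℂ)ᴴ *ᵥ
        mps d D n U) j‖ ^ 4 < x ^ 2) :
    mps d D n U ≠ 0 ∧
      ∃ (Ainf : ℂ) (Δ : ℝ),
        TimeAvgTendsto (obsAt H A (‖mpsE d D n U‖⁻¹ • mpsE d D n U)) Ainf ∧
        TimeAvgTendstoR
          (fun t => ‖obsAt H A (‖mpsE d D n U‖⁻¹ • mpsE d D n U) t - Ainf‖ ^ 2) Δ ∧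
        Δ ≤ 4 * x ^ 2 := by
  have hq : 1 / 2 < ∑ i, ‖mps d D n U i‖ ^ 2 := by nlinarith
  refine ⟨fun h0 => ?_, ?_⟩
  · simp only [h0] at hq
    norm_num at hq
  have hnorm : ‖mpsE d D n U‖ ^ 2 = ∑ i, ‖mps d D n U i‖ ^ 2 := EuclideanSpace.norm_sq_eq _
  obtain ⟨Ainf, Δ, ha, hb, hc⟩ := equilib H hH hinj hgap A hA hA1
    (‖mpsE d D n U‖⁻¹ • mpsE d D n U)
  refine ⟨Ainf, Δ, ha, hb, hc.trans ?_⟩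
  have e : ∀ j, ((hH.eigenvectorUnitary : Matrix (Fin n → Fin d) (Fin n → Fin d) ℂ)ᴴ *ᵥ
      (‖mpsE d D n U‖⁻¹ • mpsE d D n U).ofLp) j =
      (‖mpsE d D n U‖⁻¹ : ℝ) • ((hH.eigenvectorUnitary :
        Matrix (Fin n → Fin d) (Fin n → Fin d) ℂ)ᴴ *ᵥ mps d D n U) j := fun j => by
    have : (‖mpsE d D n U‖⁻¹ • mpsE d D n U).ofLp = ‖mpsE d D n U‖⁻¹ • mps d D n U := rfl
    rw [this, Matrix.mulVec_smul]
    rfl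
  simp only [e, norm_smul, mul_pow]
  rw [← Finset.mul_sum]
  have h3 : ‖(‖mpsE d D n U‖⁻¹ : ℝ)‖ ^ 4 ≤ 4 := by
    rw [norm_inv, norm_norm, inv_pow, show ‖mpsE d D n U‖ ^ 4 = (‖mpsE d D n U‖ ^ 2) ^ 2 by ring,
      hnorm]
    rw [inv_le_comm₀ (by positivity) (by norm_num)]
    nlinarith
  have h4 : 0 ≤ ∑ j, ‖((hH.eigenvectorUnitary : Matrix (Fin n → Fin d) (Fin n → Fin d) ℂ)ᴴ *ᵥ
        mps d D n U) j‖ ^ 4 := Finset.sum_nonneg fun _ _ => by positivity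
  exact mul_le_mul h3 h2.le h4 (by norm_num)
end final

/-- equilibration of random matrix product states.  Fix `d, D ≥ 2` and set
`α(d,D)` as above.  There are constants `c₁, c₂ > 0` and `N`, independent of `n`,
`H` and `A`, such that for every `n ≥ N`, every Hermitian `H` on `(ℂ^d)^{⊗n}` with
non-degenerate spectrum and non-degenerate gaps, and every Hermitian observable `A` with
operator norm `‖A‖ ≤ 1`: with probability at least `1 − e^{−c₂ α(d,D) n}` over the RMPS
`ψ ∼ μ_{d,n,D}` (site unitaries drawn i.i.d. from the Haar probability measure on
`U(dD)`, i.e. the unique left-invariant Borel probability measure), one has `ψ ≠ 0`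
and the normalized vector `ψ' = ψ/‖ψ‖` satisfies `ΔA^∞_{ψ'} ≤ e^{−c₁ α(d,D) n}`
(the infinite-time average and the temporal fluctuation existing). -/
theorem equilibration_of_rmps
    (d D : ℕ) [NeZero d] (hd : 2 ≤ d) (hD : 2 ≤ D) :
    ∃ (c₁ c₂ : ℝ) (N : ℕ), 0 < c₁ ∧ 0 < c₂ ∧
      ∀ n : ℕ, N ≤ n →
      ∀ (μ : Measure (Matrix.unitaryGroup (Fin d × Fin D) ℂ)) [IsProbabilityMeasure μ],
        (∀ V : Matrix.unitaryGroup (Fin d × Fin D) ℂ, μ.map (fun U => V * U) = μ) →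
      ∀ (H : Matrix (Fin n → Fin d) (Fin n → Fin d) ℂ) (hH : H.IsHermitian),
        Function.Injective hH.eigenvalues →
        (∀ j k l m : Fin n → Fin d, j ≠ k → l ≠ m →
          hH.eigenvalues j - hH.eigenvalues k = hH.eigenvalues l - hH.eigenvalues m →
          j = l ∧ k = m) →
      ∀ A : Matrix (Fin n → Fin d) (Fin n → Fin d) ℂ, A.IsHermitian →
        ‖Matrix.toEuclideanCLM (𝕜 := ℂ) A‖ ≤ 1 →
        ENNReal.ofReal (1 - Real.exp (-(c₂ * alphaDD d D * n)))
          ≤ (Measure.pi fun _ : Fin n => μ)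
            {U | mps d D n U ≠ 0 ∧
              ∃ (Ainf : ℂ) (Δ : ℝ),
                TimeAvgTendsto (obsAt H A (‖mpsE d D n U‖⁻¹ • mpsE d D n U)) Ainf ∧
                TimeAvgTendstoR
                  (fun t => ‖obsAt H A (‖mpsE d D n U‖⁻¹ • mpsE d D n U) t - Ainf‖ ^ 2)
                  Δ ∧
                Δ ≤ Real.exp (-(c₁ * alphaDD d D * n))} := by
  by_cases hα : alphaDD d D ≤ 0
  · refine ⟨1, 1, 0, one_pos, one_pos, ?_⟩
    intro n _ μ _ _ H hH _ _ A _ _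
    have : 1 - Real.exp (-(1 * alphaDD d D * n)) ≤ 0 := by
      have h1 : 0 ≤ -(1 * alphaDD d D * n) := by
        have : 0 ≤ -alphaDD d D * n := mul_nonneg (by linarith) (by positivity)
        linarith
      have := Real.one_le_exp h1
      linarith
    rw [ENNReal.ofReal_of_nonpos this]
    exact zero_le
  push Not at hα
  have hd' : (2 : ℝ) ≤ d := by exact_mod_cast hd
  have hD' : (2 : ℝ) ≤ D := by exact_mod_cast hD
  set r : ℝ := d * lam d D with hr
  have hr' : r = (D + 1) / (d * D + 1) := by
    rw [hr]; unfold lam; field_simp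
  have hr0 : 0 < r := by rw [hr']; positivity
  have hr1 : r < 1 := by
    rw [hr', div_lt_one (by positivity)]
    nlinarith
  set κ : ℝ := -Real.log r / 4 with hκ
  have hκ0 : 0 < κ := by
    have := Real.log_neg hr0 hr1
    rw [hκ]; linarith
  set s : ℝ := Real.exp (-κ) with hs
  have hs0 : 0 < s := Real.exp_pos _
  have hs1 : s < 1 := by rw [hs, Real.exp_lt_one_iff]; linarith
  have hs4 : s ^ 4 = r := by
    rw [hs, ← Real.exp_nat_mul, hκ]
    rw [show ((4 : ℕ) : ℝ) * -(-Real.log r / 4) = Real.log r by push_cast; ring, Real.exp_log hr0]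
  obtain ⟨N, hN⟩ := exists_pow_lt_of_lt_one (show (0 : ℝ) < 1 / (5 * D ^ 4) by positivity) hs1
  refine ⟨κ / alphaDD d D, κ / alphaDD d D, N, by positivity, by positivity, ?_⟩
  intro n hn μ _ hμ H hH hinj hgap A hA hA1
  have hexp : Real.exp (-(κ / alphaDD d D * alphaDD d D * n)) = s ^ n := by
    rw [div_mul_cancel₀ _ hα.ne', hs, ← Real.exp_nat_mul]
    congr 1; ring
  rw [hexp]
  set x : ℝ := s ^ n with hx
  have hx0 : 0 < x := by positivity
  have hxN : x * (5 * D ^ 4) ≤ 1 := by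
    have h1 : x ≤ s ^ N := pow_le_pow_of_le_one hs0.le hs1.le hn
    have h2 : x ≤ 1 / (5 * D ^ 4) := h1.trans hN.le
    rwa [le_div_iff₀ (by positivity)] at h2
  have hD4 : (1 : ℝ) ≤ D ^ 4 := one_le_pow₀ (by linarith)
  have hrn : r ^ n = x ^ 4 := by rw [← hs4, hx]; ring
  have hx1 : x ≤ 1 := by nlinarith
  set ν := (Measure.pi fun _ : Fin n => μ) with hν
  set q : (Fin n → Matrix.unitaryGroup (Fin d × Fin D) ℂ) → ℝ :=
    fun U => (∑ i, ‖mps d D n U i‖ ^ 2 - 1) ^ 2 with hqdef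
  set F : (Fin n → Matrix.unitaryGroup (Fin d × Fin D) ℂ) → ℝ :=
    fun U => ∑ j, ‖((hH.eigenvectorUnitary : Matrix (Fin n → Fin d) (Fin n → Fin d) ℂ)ᴴ *ᵥ
        mps d D n U) j‖ ^ 4 with hF
  have hqm : Measurable q := Measurable.pow_const (Measurable.sub_const
    (Finset.measurable_sum _ fun i _ => (measurable_mps i).norm.pow_const 2) 1) 2
  have hFm : Measurable F := Finset.measurable_sum _ fun j _ => Measurable.pow_const
    (Measurable.norm (Finset.measurable_sum _ fun i _ => (measurable_mps i).const_mul _)) 4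
  have hb1 : ν {U | 1 / 4 ≤ q U} ≤ ENNReal.ofReal (D ^ 4 * r ^ n / (1 / 4)) :=
    markov_real ν q hqm _ _ (by norm_num) (conc μ hD hμ n)
  have hb2 : ν {U | x ^ 2 ≤ F U} ≤ ENNReal.ofReal (D ^ 4 * r ^ n / x ^ 2) :=
    markov_real ν F hFm _ _ (by positivity) (fourth_sum μ hD hμ n hH.eigenvectorUnitary)
  have hsum : D ^ 4 * r ^ n / (1 / 4) + D ^ 4 * r ^ n / x ^ 2 ≤ x := by
    rw [hrn]
    have e : (D : ℝ) ^ 4 * x ^ 4 / (1 / 4) + D ^ 4 * x ^ 4 / x ^ 2 =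
        4 * D ^ 4 * x ^ 2 * x ^ 2 + D ^ 4 * x ^ 2 := by
      field_simp
    rw [e]
    have h1 : x ^ 2 ≤ 1 := pow_le_one₀ hx0.le hx1
    have h2 : 4 * (D : ℝ) ^ 4 * x ^ 2 * x ^ 2 ≤ 4 * D ^ 4 * x ^ 2 :=
      mul_le_of_le_one_right (by positivity) h1
    have h3 : x * (x * (5 * D ^ 4)) ≤ x := mul_le_of_le_one_right hx0.le hxN
    nlinarith
  have h4x : 4 * x ^ 2 ≤ x := by
    have : x * 4 ≤ 1 := by nlinarith
    nlinarith
  set G := {U | mps d D n U ≠ 0 ∧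
              ∃ (Ainf : ℂ) (Δ : ℝ),
                TimeAvgTendsto (obsAt H A (‖mpsE d D n U‖⁻¹ • mpsE d D n U)) Ainf ∧
                TimeAvgTendstoR
                  (fun t => ‖obsAt H A (‖mpsE d D n U‖⁻¹ • mpsE d D n U) t - Ainf‖ ^ 2)
                  Δ ∧
                Δ ≤ x} with hG
  have hcover : (Set.univ : Set (Fin n → Matrix.unitaryGroup (Fin d × Fin D) ℂ)) ⊆
      G ∪ ({U | 1 / 4 ≤ q U} ∪ {U | x ^ 2 ≤ F U}) := by
    intro U _
    by_cases h1 : 1 / 4 ≤ q U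
    · exact Or.inr (Or.inl h1)
    by_cases h2 : x ^ 2 ≤ F U
    · exact Or.inr (Or.inr h2)
    left
    obtain ⟨h0, Ainf, Δ, ha, hb, hc⟩ := good_of n U H hH hinj hgap A hA hA1 x
      (not_le.mp h1) (not_le.mp h2)
    exact ⟨h0, Ainf, Δ, ha, hb, hc.trans h4x⟩
  have hone : (1 : ENNReal) ≤ ν G + ENNReal.ofReal x := by
    have : ν Set.univ = 1 := measure_univ
    rw [← this]
    refine (measure_mono hcover).trans ((measure_union_le _ _).trans ?_)
    gcongr
    refine (measure_union_le _ _).trans ((add_le_add hb1 hb2).trans ?_)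
    rw [← ENNReal.ofReal_add (by positivity) (by positivity)]
    exact ENNReal.ofReal_le_ofReal hsum
  rw [ENNReal.ofReal_sub _ hx0.le, ENNReal.ofReal_one]
  exact tsub_le_iff_right.mpr hone
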